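/- arXiv:math/0201265 — 3 statements merged into one kernel-verified Lean document; each statement's English description precedes it below -/
import Mathlib

section
/- For every positive integer n, τ(n) ≡ σ₁₁(n) (mod 691), where σ₁₁(n) = ∑_{d | n} d^{11}. -/
open Finset

/-- Ramanujan's tau function, defined by
`q ∏_{n≥1} (1 - q^n)^24 = ∑_{n≥1} τ(n) q^n`; the coefficient of `q^n` only
involves the factors with index at most `n`. -/
noncomputable def ramanujanTau (n : ℕ) : ℤ :=
  (Polynomial.X * ∏ k ∈ Finset.Icc 1 n, ((1 : Polynomial ℤ) - Polynomial.X ^ k) ^ 24).coeff n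

open Polynomial in
lemma tau_stable (n N : ℕ) (h : n ≤ N) :
    (X * ∏ k ∈ Finset.Icc 1 N, ((1 : ℤ[X]) - X ^ k) ^ 24).coeff n = ramanujanTau n := by
  induction N, h using Nat.le_induction with
  | base => rfl
  | succ N hN ih =>
    rw [Finset.prod_Icc_succ_top (by omega), ← ih]
    obtain ⟨Q, hQ⟩ : (X : ℤ[X]) ^ (N + 1) ∣ (1 - X ^ (N + 1)) ^ 24 - 1 := by
      have := sub_dvd_pow_sub_pow ((1 : ℤ[X]) - X ^ (N + 1)) 1 24
      simpa using this
    rw [sub_eq_iff_eq_add.mp hQ]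
    set A := ∏ k ∈ Finset.Icc 1 N, ((1 : ℤ[X]) - X ^ k) ^ 24
    rw [show X * (A * (X ^ (N + 1) * Q + 1)) = X * A + X ^ (N + 1) * (X * A * Q) by ring,
      coeff_add, coeff_X_pow_mul', if_neg (by omega), add_zero]

open Polynomial in
lemma tendsto_iter (P : ℕ → ℂ[X]) (F : ℂ → ℂ) {U : Set ℂ} (hU : IsOpen U)
    (h : TendstoLocallyUniformlyOn (fun N q ↦ (P N).eval q) F Filter.atTop U) (m : ℕ) :
    TendstoLocallyUniformlyOn (fun N q ↦ (derivative^[m] (P N)).eval q) (iteratedDeriv m F)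
      Filter.atTop U := by
  induction m with
  | zero => simpa using h
  | succ m ih =>
    have := ih.deriv (Filter.Eventually.of_forall fun N ↦ (Polynomial.differentiableOn _)) hU
    rw [iteratedDeriv_succ]
    convert this using 1
    funext N q
    simp [Function.iterate_succ_apply']

lemma tluo_pow {X : Type*} [TopologicalSpace X] {f : ℕ → X → ℂ} {g : X → ℂ} {s : Set X}
    (h : TendstoLocallyUniformlyOn f g Filter.atTop s) (hg : ContinuousOn g s) (k : ℕ) :
    TendstoLocallyUniformlyOn (fun N x ↦ f N x ^ k) (fun x ↦ g x ^ k) Filter.atTop s := by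
  induction k with
  | zero =>
    simp only [pow_zero]
    exact fun u hu x hx ↦ ⟨_, self_mem_nhdsWithin,
      Filter.Eventually.of_forall fun _ _ _ ↦ mem_uniformity_of_eq hu rfl⟩
  | succ k ih =>
    simp only [pow_succ]
    exact ih.mul₀ h (hg.pow k) hg

lemma disc_tlu : TendstoLocallyUniformlyOn
    (fun N q ↦ ((Polynomial.X * ∏ k ∈ Finset.Icc 1 N, ((1 : Polynomial ℤ) - Polynomial.X ^ k) ^ 24).map
      (Int.castRingHom ℂ)).eval q) (fun q ↦ q * (∏' i : ℕ, (1 - q ^ (i + 1))) ^ 24) Filter.atTop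
      (Metric.ball (0:ℂ) 1) := by
  have h := ModularForm.multipliableLocallyUniformlyOn_one_sub_pow.hasProdLocallyUniformlyOn
  have h2 : TendstoLocallyUniformlyOn (fun (N : ℕ) (q : ℂ) ↦ ∏ i ∈ Finset.range N, (1 - q ^ (i+1)))
    (fun q ↦ ∏' i : ℕ, (1 - q ^ (i + 1))) Filter.atTop (Metric.ball (0:ℂ) 1) := by
    intro u hu x hx
    obtain ⟨t, ht, ht2⟩ := h u hu x hx
    refine ⟨t, ht, ?_⟩
    simpa [Finset.prod_apply] using Filter.tendsto_finset_range.eventually ht2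
  have hc := ModularForm.differentiableOn_tprod_one_sub_pow.continuousOn
  have hid : TendstoLocallyUniformlyOn (fun (_ : ℕ) (q : ℂ) ↦ q) (fun q ↦ q) Filter.atTop
      (Metric.ball (0:ℂ) 1) := fun u hu x hx ↦ ⟨_, self_mem_nhdsWithin,
        Filter.Eventually.of_forall fun _ _ _ ↦ mem_uniformity_of_eq hu rfl⟩
  convert hid.fun_mul₀ (tluo_pow h2 hc 24) continuousOn_id (hc.pow 24) using 1
  funext N q
  simp only [Polynomial.map_mul, Polynomial.map_X, Polynomial.eval_mul, Polynomial.eval_X]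
  congr 1
  rw [Finset.prod_pow]
  simp only [Polynomial.map_pow, Polynomial.eval_pow, Polynomial.map_prod, Polynomial.eval_prod]
  congr 1
  simp only [Polynomial.map_sub, Polynomial.map_one, Polynomial.map_pow, Polynomial.map_X,
    Polynomial.eval_sub, Polynomial.eval_one, Polynomial.eval_pow, Polynomial.eval_X]
  induction N with
  | zero => simp
  | succ N ih => rw [Finset.prod_Icc_succ_top (by omega), Finset.prod_range_succ, ih]

lemma disc_coeff (n : ℕ) :
    (UpperHalfPlane.qExpansion 1 ModularForm.discriminant).coeff n = (ramanujanTau n : ℂ) := by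
  have hmem : (0 : ℂ) ∈ Metric.ball (0 : ℂ) 1 := Metric.mem_ball_self one_pos
  have h1 := (tendsto_iter _ _ Metric.isOpen_ball disc_tlu n).tendsto_at hmem
  have h2 : UpperHalfPlane.cuspFunction 1 ModularForm.discriminant =ᶠ[nhds 0]
      (fun q ↦ q * (∏' i : ℕ, (1 - q ^ (i + 1))) ^ 24) := by
    filter_upwards [Metric.isOpen_ball.mem_nhds hmem] with q hq
    rw [ModularForm.discriminant_cuspFunction_eqOn hq]
    dsimp only
    rw [(ModularForm.multipliable_one_sub_pow (by simpa using hq)).tprod_pow]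
  rw [UpperHalfPlane.qExpansion_coeff, h2.iteratedDeriv_eq]
  have h3 : iteratedDeriv n (fun q : ℂ ↦ q * (∏' i : ℕ, (1 - q ^ (i + 1))) ^ 24) 0 =
      n.factorial * (ramanujanTau n : ℂ) := by
    refine tendsto_nhds_unique h1 (tendsto_const_nhds.congr' ?_)
    filter_upwards [Filter.eventually_ge_atTop n] with N hN
    rw [← Polynomial.coeff_zero_eq_eval_zero, Polynomial.coeff_iterate_derivative, zero_add,
      Polynomial.coeff_map, tau_stable n N hN, Nat.descFactorial_self]
    simp
  rw [h3, inv_mul_cancel_left₀]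
  exact_mod_cast n.factorial_ne_zero

open ModularForm EisensteinSeries UpperHalfPlane CongruenceSubgroup MatrixGroups in
lemma key (n : ℕ) (hn : 1 ≤ n) : ∃ a : ℤ,
    65520 * (ArithmeticFunction.sigma 11 n : ℤ) - 691 * a = 762048 * ramanujanTau n := by
  have hE6 : ∀ m, (qExpansion 1 E₆).coeff m =
      ((if m = 0 then 1 else -504 * (ArithmeticFunction.sigma 5 m : ℤ) : ℤ) : ℂ) := by
    intro m
    rw [E_qExpansion_coeff _ ⟨3, rfl⟩]
    split_ifs <;> norm_num [show bernoulli 6 = 1 / 42 by decide +kernel]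
  have h12 : 3 ≤ 12 := by norm_num
  have hE12 : ∀ m, (qExpansion 1 (E h12)).coeff m =
      if m = 0 then 1 else 65520 / 691 * (ArithmeticFunction.sigma 11 m : ℂ) := by
    intro m
    rw [E_qExpansion_coeff _ ⟨6, rfl⟩]
    split_ifs <;> norm_num [show bernoulli 12 = -691 / 2730 by decide +kernel]
  let f : ModularForm 𝒮ℒ 12 := ModularForm.mcast (by decide) (E h12) - ModularForm.mcast (by decide) (E₆.pow 2)
  have hf : qExpansion 1 f = qExpansion 1 (E h12) - qExpansion 1 E₆ ^ 2 := by
    simp only [f, FunLike.coe_sub, coe_mcast,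
      ModularForm.qExpansion_sub one_pos one_mem_strictPeriods_SL,
      ModularForm.qExpansion_pow one_pos one_mem_strictPeriods_SL]
  have hcusp : IsCuspForm f := by
    rw [isCuspForm_iff_coeffZero_eq_zero, hf, map_sub, pow_two, PowerSeries.coeff_mul]
    simp [hE12, hE6, -PowerSeries.coeff_zero_eq_constantCoeff]
  obtain ⟨g, hg⟩ := hcusp
  obtain ⟨c, hc⟩ := CuspForm.exists_smul_discriminant_of_weight_eq_twelve g
  have hgE : (g : ℍ → ℂ) = f := congrArg DFunLike.coe hg
  have hcΔ : (c • CuspForm.discriminant : ℍ → ℂ) = g := congrArg DFunLike.coe hc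
  have hgΔ := ModularForm.qExpansion_smul one_pos one_mem_strictPeriods_SL c
    CuspForm.discriminant
  rw [hcΔ, hgE, hf] at hgΔ
  have hco : ∀ m, (qExpansion 1 (E h12)).coeff m - (qExpansion 1 E₆ ^ 2).coeff m
      = c * (ramanujanTau m : ℂ) := by
    intro m
    rw [← disc_coeff, ← map_sub, hgΔ]
    simp
  have hc_eq : c = 762048 / 691 := by
    have h1 := disc_coeff 1
    rw [discriminant_qExpansion_coeff_one] at h1
    have := hco 1
    rw [← h1, pow_two, PowerSeries.coeff_mul] at this
    simp only [hE12, hE6, Finset.Nat.antidiagonal_succ] at this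
    norm_num at this
    rw [← this]
  let p : PowerSeries ℤ := PowerSeries.mk fun m ↦
    (if m = 0 then 1 else -504 * (ArithmeticFunction.sigma 5 m : ℤ) : ℤ)
  have hp : qExpansion 1 E₆ = p.map (Int.castRingHom ℂ) := by
    ext m
    rw [hE6, PowerSeries.coeff_map, PowerSeries.coeff_mk]
    simp
  refine ⟨(p ^ 2).coeff n, ?_⟩
  have := hco n
  rw [hp, ← map_pow, PowerSeries.coeff_map, hE12, if_neg (by omega), hc_eq] at this
  have h2 : (65520 * (ArithmeticFunction.sigma 11 n : ℂ) - 691 * ((p ^ 2).coeff n : ℤ))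
    = 762048 * (ramanujanTau n : ℂ) := by
    simp only [eq_intCast] at this
    linear_combination 691 * this
  exact_mod_cast h2

/-- `τ(n) ≡ σ₁₁(n) (mod 691)`. -/
theorem tau_congruent_mod_691 (n : ℕ) (hn : 1 ≤ n) :
    ramanujanTau n ≡ (ArithmeticFunction.sigma 11 n : ℤ) [ZMOD 691] := by
  obtain ⟨a, ha⟩ := key n hn
  rw [Int.modEq_iff_dvd]
  omega
end

section
/- Wilton's congruences: for every prime p, τ(p) ≡ 1 (mod 23) if p = 23; τ(p) ≡ 0 (mod 23) if p is a quadratic non-residue modulo 23; τ(p) ≡ 2 (mod 23) if p can be written as p = U² + 23·V² with integers U, V and U ≠ 0; and τ(p) ≡ −1 (mod 23) for all remaining primes p ≠ 23. -/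
open Finset

instance : Fact (Nat.Prime 23) := ⟨by norm_num⟩

namespace Wilton

lemma prod_coeff_stable (n i d : ℕ) (hi : i ≤ n) :
    (∏ k ∈ range (n + d), (1 - PowerSeries.X ^ (k + 1) : PowerSeries (ZMod 23))).coeff i =
    (∏ k ∈ range n, (1 - PowerSeries.X ^ (k + 1) : PowerSeries (ZMod 23))).coeff i := by
  induction d with
  | zero => rfl
  | succ d ih =>
    rw [← add_assoc, prod_range_succ, mul_sub, mul_one, map_sub, ih,
      PowerSeries.coeff_mul_X_pow', if_neg (by omega), sub_zero]

lemma prod_coeff (n i : ℕ) (hi : i ≤ n) :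
    (∏ k ∈ range n, (1 - PowerSeries.X ^ (k + 1) : PowerSeries (ZMod 23))).coeff i =
    (PowerSeries.pentagonalSeries (ZMod 23)).coeff i := by
  have h := PowerSeries.coeff_prod_one_sub_X_pow_eventually_eq (ZMod 23) i
  rw [Filter.eventually_atTop] at h
  obtain ⟨s, hs⟩ := h
  obtain ⟨M, hM⟩ := s.exists_nat_subset_range
  rw [← hs (range (n + M)) (hM.trans (range_subset_range.2 (by omega))), prod_coeff_stable n i M hi]

noncomputable def P (n : ℕ) : Polynomial (ZMod 23) :=
  ∏ k ∈ Finset.Icc 1 n, (1 - Polynomial.X ^ k)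

lemma P_coeff (n i : ℕ) (hi : i ≤ n) :
    (P n).coeff i = (PowerSeries.pentagonalSeries (ZMod 23)).coeff i := by
  rw [← prod_coeff n i hi, ← Polynomial.coeff_coe]
  congr 1
  have : P n = ∏ k ∈ range n, (1 - Polynomial.X ^ (k + 1)) := by
    rw [P]
    clear hi
    induction n with
    | zero => simp
    | succ n ih => rw [Finset.prod_Icc_succ_top (by omega), ih, prod_range_succ]
  rw [this]
  have := map_prod (Polynomial.coeToPowerSeries.ringHom (R := ZMod 23)) (fun k => (1 - Polynomial.X ^ (k + 1))) (range n)
  rw [Polynomial.coeToPowerSeries.ringHom_apply] at this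
  rw [this]
  refine prod_congr rfl fun k _ => ?_
  rw [map_sub, map_pow, map_one, Polynomial.coeToPowerSeries.ringHom_apply, Polynomial.coe_X]

def sgn (j : ℤ) : ZMod 23 := ((j.negOnePow : ℤˣ) : ℤ)

lemma pent_id (j : ℤ) : 24 * (pentagonal j : ℤ) + 1 = (6 * j - 1) ^ 2 := by
  have := two_mul_natCast_pentagonal j
  linear_combination 12 * this

lemma P_coeff_sum (n i : ℕ) (hi : i ≤ n) :
    (P n).coeff i = ∑ j ∈ Icc (-n : ℤ) n, if pentagonal j = i then sgn j else 0 := by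
  rw [P_coeff n i hi]
  by_cases h : i ∈ Set.range pentagonal
  · obtain ⟨j, rfl⟩ := h
    rw [PowerSeries.coeff_pentagonalSeries_pentagonal, Finset.sum_eq_single j]
    · simp [sgn]
    · intro b _ hb
      rw [if_neg]
      exact fun h => hb (pentagonal_injective h)
    · intro hj
      exfalso
      apply hj
      have := pent_id j
      rw [mem_Icc]
      have h2 : (pentagonal j : ℤ) ≤ n := by exact_mod_cast hi
      constructor <;> nlinarith
  · rw [PowerSeries.coeff_pentagonalSeries_eq_zero _ h, Finset.sum_eq_zero]
    intro j _
    rw [if_neg]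
    exact fun hj => h ⟨j, hj⟩

lemma tau_eq_coeff (n : ℕ) (hn : 1 ≤ n) :
    (ramanujanTau n : ZMod 23) = (P n * Polynomial.expand (ZMod 23) 23 (P n)).coeff (n - 1) := by
  have h1 : (Polynomial.X * ∏ k ∈ Finset.Icc 1 n, ((1 : Polynomial ℤ) - Polynomial.X ^ k) ^ 24).map
      (Int.castRingHom (ZMod 23)) = Polynomial.X * (P n * Polynomial.expand (ZMod 23) 23 (P n)) := by
    rw [ZMod.expand_card, ← pow_succ']
    simp [P, Polynomial.map_prod, Finset.prod_pow]
  obtain ⟨m, rfl⟩ := Nat.exists_eq_add_of_le' hn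
  rw [Nat.add_sub_cancel, ← Polynomial.coeff_X_mul, ← h1, Polynomial.coeff_map]
  rfl

lemma tau_sum (n : ℕ) (hn : 1 ≤ n) (T : Finset (ℤ × ℤ))
    (hT : ∀ j k : ℤ, (j, k) ∈ T ↔ (6 * j - 1) ^ 2 + 23 * (6 * k - 1) ^ 2 = 24 * (n : ℤ)) :
    (ramanujanTau n : ZMod 23) = ∑ t ∈ T, sgn t.1 * sgn t.2 := by
  have key : ∀ j k : ℤ, pentagonal j + 23 * pentagonal k = n - 1 ↔ (j, k) ∈ T := by
    intro j k
    rw [hT, ← pent_id, ← pent_id]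
    omega
  have hbd : ∀ j k : ℤ, (j, k) ∈ T → (j, k) ∈ Icc (-n : ℤ) n ×ˢ Icc (-n : ℤ) n := by
    intro j k h
    rw [hT] at h
    rw [mem_product, mem_Icc, mem_Icc]
    refine ⟨⟨?_, ?_⟩, ⟨?_, ?_⟩⟩ <;> nlinarith [sq_nonneg (6 * j - 1), sq_nonneg (6 * k - 1)]
  rw [tau_eq_coeff n hn, Polynomial.coeff_mul]
  have h1 : ∀ x ∈ antidiagonal (n - 1), (P n).coeff x.1 * (Polynomial.expand (ZMod 23) 23 (P n)).coeff x.2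
      = ∑ t ∈ Icc (-n : ℤ) n ×ˢ Icc (-n : ℤ) n,
        if (pentagonal t.1, 23 * pentagonal t.2) = x then sgn t.1 * sgn t.2 else 0 := by
    rintro ⟨i, l⟩ hx
    rw [HasAntidiagonal.mem_antidiagonal] at hx
    simp only at hx ⊢
    rw [Polynomial.coeff_expand (by norm_num)]
    by_cases hl : 23 ∣ l
    · obtain ⟨l, rfl⟩ := hl
      rw [if_pos ⟨l, rfl⟩, Nat.mul_div_cancel_left _ (by norm_num), P_coeff_sum n i (by omega),
        P_coeff_sum n l (by omega), Finset.sum_mul_sum, Finset.sum_product]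
      refine sum_congr rfl fun j _ => sum_congr rfl fun k _ => ?_
      by_cases h1 : pentagonal j = i <;> by_cases h2 : pentagonal k = l <;> simp [h1, h2]
    · rw [if_neg hl, mul_zero]
      symm
      refine Finset.sum_eq_zero fun j _ => ?_
      rw [if_neg]
      intro h
      rw [Prod.mk.injEq] at h
      exact hl ⟨_, h.2.symm⟩
  rw [sum_congr rfl h1, sum_comm]
  rw [← Finset.sum_subset (s₁ := T) (fun t ht => hbd t.1 t.2 ht)]
  · refine sum_congr rfl fun t ht => ?_
    rw [Finset.sum_ite_eq, if_pos]
    rw [HasAntidiagonal.mem_antidiagonal]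
    exact (key _ _).2 ht
  · intro t _ ht
    rw [Finset.sum_ite_eq, if_neg]
    rw [HasAntidiagonal.mem_antidiagonal]
    exact fun h => ht ((key _ _).1 h)

lemma sgn_mul (j k : ℤ) : sgn j * sgn k = sgn (j - k) := by
  rw [sgn, sgn, sgn, Int.negOnePow_sub]; push_cast; rfl

lemma sgn_even (j : ℤ) (h : Even j) : sgn j = 1 := by
  simp [sgn, Int.negOnePow_even j h]
lemma sgn_odd (j : ℤ) (h : Odd j) : sgn j = -1 := by
  simp [sgn, Int.negOnePow_odd j h]

/-- reduction of binary quadratic forms of discriminant -23 -/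
lemma reduce (N : ℕ) : ∀ A B C : ℤ, 0 < A → A ≤ N → 4 * A * C - B ^ 2 = 23 →
    ∃ α β γ δ : ℤ,
      (∀ x y : ℤ, A * x ^ 2 + B * x * y + C * y ^ 2 =
        (α * x + β * y) ^ 2 + (α * x + β * y) * (γ * x + δ * y) + 6 * (γ * x + δ * y) ^ 2) ∨
      (∀ x y : ℤ, A * x ^ 2 + B * x * y + C * y ^ 2 =
        2 * (α * x + β * y) ^ 2 + (α * x + β * y) * (γ * x + δ * y) + 3 * (γ * x + δ * y) ^ 2) := by
  induction N with
  | zero => intro A B C h1 h2; push_cast at h2; omega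
  | succ N ih =>
    -- first the case where |B| ≤ A
    have main : ∀ A B C : ℤ, 0 < A → A ≤ (N + 1 : ℕ) → 4 * A * C - B ^ 2 = 23 → -A ≤ B → B ≤ A →
      ∃ α β γ δ : ℤ,
      (∀ x y : ℤ, A * x ^ 2 + B * x * y + C * y ^ 2 =
        (α * x + β * y) ^ 2 + (α * x + β * y) * (γ * x + δ * y) + 6 * (γ * x + δ * y) ^ 2) ∨
      (∀ x y : ℤ, A * x ^ 2 + B * x * y + C * y ^ 2 =
        2 * (α * x + β * y) ^ 2 + (α * x + β * y) * (γ * x + δ * y) + 3 * (γ * x + δ * y) ^ 2) := by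
      intro A B C hA hAN hd hB1 hB2
      by_cases hC : C < A
      · have hC0 : 0 < C := by
          by_contra hc
          nlinarith [sq_nonneg B]
        obtain ⟨α, β, γ, δ, h⟩ := ih C B A hC0 (by push_cast at hAN; omega) (by linarith)
        refine ⟨β, α, δ, γ, ?_⟩
        rcases h with h | h
        · left; intro x y; have := h y x; linear_combination this
        · right; intro x y; have := h y x; linear_combination this
      · have hA2 : A ≤ 2 := by nlinarith
        have : A = 1 ∨ A = 2 := by omega
        rcases this with rfl | rfl
        · have : B = -1 ∨ B = 0 ∨ B = 1 := by omega
          rcases this with rfl | rfl | rfl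
          · obtain rfl : C = 6 := by omega
            exact ⟨1, 0, 0, -1, Or.inl fun x y => by ring⟩
          · omega
          · obtain rfl : C = 6 := by omega
            exact ⟨1, 0, 0, 1, Or.inl fun x y => by ring⟩
        · have : B = -2 ∨ B = -1 ∨ B = 0 ∨ B = 1 ∨ B = 2 := by omega
          rcases this with rfl | rfl | rfl | rfl | rfl
          · omega
          · obtain rfl : C = 3 := by omega
            exact ⟨1, 0, 0, -1, Or.inr fun x y => by ring⟩
          · omega
          · obtain rfl : C = 3 := by omega
            exact ⟨1, 0, 0, 1, Or.inr fun x y => by ring⟩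
          · omega
    intro A B C hA hAN hd
    -- shift
    obtain ⟨k, hk1, hk2⟩ : ∃ k : ℤ, -A ≤ B + 2 * A * k ∧ B + 2 * A * k ≤ A := by
      refine ⟨-((B + A) / (2 * A)), ?_, ?_⟩
      · have := Int.mul_ediv_self_le (x := B + A) (k := 2 * A) (by omega)
        linarith
      · have := Int.lt_mul_ediv_self_add (x := B + A) (k := 2 * A) (by omega)
        linarith
    obtain ⟨α, β, γ, δ, h⟩ := main A (B + 2 * A * k) (A * k ^ 2 + B * k + C) hA hAN
      (by linear_combination hd) hk1 hk2
    refine ⟨α, β - α * k, γ, δ - γ * k, ?_⟩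
    rcases h with h | h
    · left; intro x y; have := h (x - k * y) y; linear_combination this
    · right; intro x y; have := h (x - k * y) y; linear_combination this


lemma descent (p : ℕ) (hp : p.Prime) (c d X Y x y : ℤ)
    (h1 : X ^ 2 + 23 * Y ^ 2 = c * p) (h2 : x ^ 2 + 23 * y ^ 2 = d * p) :
    ∃ n m : ℤ, n ^ 2 + 23 * m ^ 2 = c * d ∧ (c * y = n * Y - m * X ∨ c * y = -n * Y - m * X) := by
  have hpp : Prime (p : ℤ) := Nat.prime_iff_prime_int.mp hp
  have hp0 : (p : ℤ) ≠ 0 := hpp.ne_zero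
  have aux : ∀ Y : ℤ, X ^ 2 + 23 * Y ^ 2 = c * p → (p : ℤ) ∣ x * Y - y * X →
      ∃ n m : ℤ, n ^ 2 + 23 * m ^ 2 = c * d ∧ c * y = n * Y - m * X := by
    intro Y h1 ⟨m, hm⟩
    have hn : (p : ℤ) ∣ (x * X + 23 * y * Y) := by
      apply hpp.dvd_of_dvd_pow (n := 2)
      refine ⟨p * (c * d - 23 * m ^ 2), ?_⟩
      linear_combination (x ^ 2 + 23 * y ^ 2) * h1 + c * p * h2
        - 23 * (x * Y - y * X + p * m) * hm
    obtain ⟨n, hn⟩ := hn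
    refine ⟨n, m, ?_, ?_⟩
    · apply mul_left_cancel₀ (pow_ne_zero 2 hp0)
      linear_combination (x ^ 2 + 23 * y ^ 2) * h1 + c * p * h2
        - 23 * (x * Y - y * X + p * m) * hm - (x * X + 23 * y * Y + p * n) * hn
    · apply mul_left_cancel₀ hp0
      linear_combination Y * hn - X * hm - y * h1
  have hd : (p : ℤ) ∣ (x * Y - y * X) * (x * (-Y) - y * X) := by
    refine ⟨c * y ^ 2 - d * Y ^ 2, ?_⟩
    linear_combination y ^ 2 * h1 - Y ^ 2 * h2
  rcases hpp.dvd_or_dvd hd with h | h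
  · obtain ⟨n, m, h3, h4⟩ := aux Y h1 h
    exact ⟨n, m, h3, Or.inl h4⟩
  · obtain ⟨n, m, h3, h4⟩ := aux (-Y) (by linarith [neg_sq Y]) h
    exact ⟨n, m, h3, Or.inr (by linear_combination h4)⟩

lemma uniq1 (p : ℕ) (hp : p.Prime) (U V x y : ℤ) (h1 : (p : ℤ) = U ^ 2 + 23 * V ^ 2)
    (h2 : x ^ 2 + 23 * y ^ 2 = 24 * p) :
    y = U + V ∨ y = -(U + V) ∨ y = U - V ∨ y = -(U - V) := by
  obtain ⟨n, m, h3, h4⟩ := descent p hp 1 24 U V x y (by linarith) h2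
  have hm1 : m ≤ 1 := by nlinarith [sq_nonneg n]
  have hm2 : -1 ≤ m := by nlinarith [sq_nonneg n]
  have hn1 : n ≤ 4 := by nlinarith [sq_nonneg m]
  have hn2 : -4 ≤ n := by nlinarith [sq_nonneg m]
  interval_cases m <;> interval_cases n <;> omega

lemma uniq2 (p : ℕ) (hp : p.Prime) (hodd : p % 2 = 1) (a b x y : ℤ)
    (h1 : (p : ℤ) = 2 * a ^ 2 + a * b + 3 * b ^ 2) (ha : a % 2 = 0) (hb : b % 2 = 1)
    (h2 : x ^ 2 + 23 * y ^ 2 = 24 * p) :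
    y = b - a ∨ y = -(b - a) := by
  obtain ⟨n, m, h3, h4⟩ := descent p hp 8 24 (4 * a + b) b x y (by rw [h1]; ring) h2
  have hm1 : m ≤ 2 := by nlinarith [sq_nonneg n]
  have hm2 : -2 ≤ m := by nlinarith [sq_nonneg n]
  have hn1 : n ≤ 13 := by nlinarith [sq_nonneg m]
  have hn2 : -13 ≤ n := by nlinarith [sq_nonneg m]
  have h5 : (m = 2 ∨ m = -2) ∧ (n = 10 ∨ n = -10) ∨ (m = 1 ∨ m = -1) ∧ (n = 13 ∨ n = -13) := by
    interval_cases m <;> interval_cases n <;> omega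
  rcases h5 with ⟨rfl | rfl, rfl | rfl⟩ | ⟨rfl | rfl, rfl | rfl⟩ <;> omega

lemma sq_case (j k : ℤ) (h : (6 * j - 1) ^ 2 = (6 * k - 1) ^ 2) : j = k := by
  rcases sq_eq_sq_iff_eq_or_eq_neg.mp h with h | h <;> omega

lemma single (p : ℕ) (hp : 1 ≤ p) (j0 k0 : ℤ)
    (hs : (6 * j0 - 1) ^ 2 + 23 * (6 * k0 - 1) ^ 2 = 24 * (p : ℤ))
    (hu : ∀ j k : ℤ, (6 * j - 1) ^ 2 + 23 * (6 * k - 1) ^ 2 = 24 * (p : ℤ) → k = k0) :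
    (ramanujanTau p : ZMod 23) = sgn (j0 - k0) := by
  rw [tau_sum p hp {(j0, k0)}]
  · simp [sgn_mul]
  · intro j k
    rw [mem_singleton, Prod.mk.injEq]
    constructor
    · rintro ⟨rfl, rfl⟩; exact hs
    · intro h
      have := hu j k h
      subst this
      exact ⟨sq_case _ _ (by linarith), rfl⟩

lemma small (p : ℕ) (hp : p ≤ 23) (j k : ℤ)
    (h : (6 * j - 1) ^ 2 + 23 * (6 * k - 1) ^ 2 = 24 * (p : ℤ)) : k = 0 := by
  have : (p : ℤ) ≤ 23 := by exact_mod_cast hp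
  have h1 : k < 1 := by nlinarith [sq_nonneg (6 * j - 1)]
  have h2 : -1 < k := by nlinarith [sq_nonneg (6 * j - 1)]
  omega

lemma case_one_core (p : ℕ) (hp : p.Prime) (U V k1 k2 e : ℤ) (hU : U ≠ 0) (hV : V ≠ 0)
    (he : e = 1 ∨ e = -1) (h : (p : ℤ) = U ^ 2 + 23 * V ^ 2)
    (h1 : U + V = 6 * k1 - 1) (h2 : e * (U - V) = 6 * k2 - 1) :
    (ramanujanTau p : ZMod 23) = 2 := by
  have he2 : e ^ 2 = 1 := by rcases he with rfl | rfl <;> norm_num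
  have hne : k1 ≠ k2 := by
    rintro rfl
    rcases he with rfl | rfl <;> omega
  have e1 : (6 * (k1 - 4 * V) - 1) ^ 2 + 23 * (6 * k1 - 1) ^ 2 = 24 * (p : ℤ) := by
    rw [show 6 * (k1 - 4 * V) - 1 = U - 23 * V by linarith, ← h1, h]; ring
  have e2 : (6 * (k2 + 4 * e * V) - 1) ^ 2 + 23 * (6 * k2 - 1) ^ 2 = 24 * (p : ℤ) := by
    rw [show 6 * (k2 + 4 * e * V) - 1 = e * (U + 23 * V) by linarith, ← h2, h]
    linear_combination ((U + 23 * V) ^ 2 + 23 * (U - V) ^ 2) * he2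
  rw [tau_sum p hp.one_le {(k1 - 4 * V, k1), (k2 + 4 * e * V, k2)}]
  · rw [sum_pair (by simp [hne])]
    simp only [sgn_mul]
    rw [sgn_even _ ⟨-2 * V, by ring⟩, sgn_even _ ⟨2 * e * V, by ring⟩]
    norm_num
  · intro j k
    rw [mem_insert, mem_singleton, Prod.mk.injEq, Prod.mk.injEq]
    constructor
    · rintro (⟨rfl, rfl⟩ | ⟨rfl, rfl⟩)
      · exact e1
      · exact e2
    · intro hjk
      have hk : k = k1 ∨ k = k2 := by
        have := uniq1 p hp U V _ _ h hjk
        rcases he with rfl | rfl <;> omega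
      rcases hk with rfl | rfl
      · exact Or.inl ⟨sq_case _ _ (by linarith), rfl⟩
      · exact Or.inr ⟨sq_case _ _ (by linarith), rfl⟩

lemma emod_cases (p : ℤ) (h2 : ¬ (2 : ℤ) ∣ p) (h3 : ¬ (3 : ℤ) ∣ p) : p % 6 = 1 ∨ p % 6 = 5 := by
  omega

lemma case_one (p : ℕ) (hp : p.Prime) (U V : ℤ) (hU : U ≠ 0) (h : (p : ℤ) = U ^ 2 + 23 * V ^ 2) :
    (ramanujanTau p : ZMod 23) = 2 := by
  have hpp : Prime (p : ℤ) := Nat.prime_iff_prime_int.mp hp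
  have hV : V ≠ 0 := by
    rintro rfl
    have : (p : ℤ) = U ^ 2 := by linarith
    rw [this] at hpp
    exact not_prime_pow (by norm_num) hpp
  have hbig : 23 ≤ (p : ℤ) := by
    have : 0 < V ^ 2 := by positivity
    nlinarith [sq_nonneg U]
  have hbig' : 23 ≤ p := by exact_mod_cast hbig
  have n2 : ¬ (2 : ℤ) ∣ p := by
    intro hd
    have := (Nat.prime_dvd_prime_iff_eq Nat.prime_two hp).1 (by exact_mod_cast hd)
    omega
  have n3 : ¬ (3 : ℤ) ∣ p := by
    intro hd
    have := (Nat.prime_dvd_prime_iff_eq Nat.prime_three hp).1 (by exact_mod_cast hd)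
    omega
  have e6 : (p : ℤ) = (U + V) * (U - V) + 6 * (4 * V ^ 2) := by rw [h]; ring
  have hs : ∀ s t : ℤ, (p : ℤ) = s * t + 6 * (4 * V ^ 2) → s % 6 = 1 ∨ s % 6 = 5 := by
    intro s t hst
    apply emod_cases
    · intro hd
      exact n2 (hst ▸ dvd_add (hd.mul_right _) ⟨3 * (4 * V ^ 2), by ring⟩)
    · intro hd
      exact n3 (hst ▸ dvd_add (hd.mul_right _) ⟨2 * (4 * V ^ 2), by ring⟩)
  have s1 := hs _ _ e6
  have s2 := hs (U - V) (U + V) (by rw [e6]; ring)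
  have wl : ∀ U V : ℤ, U ≠ 0 → V ≠ 0 → (p : ℤ) = U ^ 2 + 23 * V ^ 2 → (U + V) % 6 = 5 →
      ((U - V) % 6 = 1 ∨ (U - V) % 6 = 5) → (ramanujanTau p : ZMod 23) = 2 := by
    intro U V hU hV h h1 h2
    rcases h2 with h2 | h2
    · exact case_one_core p hp U V ((U + V + 1) / 6) ((V - U + 1) / 6) (-1) hU hV (Or.inr rfl) h
        (by omega) (by omega)
    · exact case_one_core p hp U V ((U + V + 1) / 6) ((U - V + 1) / 6) 1 hU hV (Or.inl rfl) h
        (by omega) (by omega)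
  rcases s1 with s1 | s1
  · exact wl (-U) (-V) (by simpa using hU) (by simpa using hV) (by rw [h]; ring) (by omega) (by omega)
  · exact wl U V hU hV h s1 s2

lemma case_two (p : ℕ) (hp : p.Prime) (a b : ℤ)
    (h : (p : ℤ) = 2 * a ^ 2 + a * b + 3 * b ^ 2) :
    (ramanujanTau p : ZMod 23) = -1 := by
  by_cases p2 : p = 2
  · subst p2
    rw [single 2 (by norm_num) 1 0 (by norm_num) (small 2 (by norm_num))]
    exact sgn_odd _ (by decide)
  by_cases p3 : p = 3
  · subst p3
    rw [single 3 (by norm_num) (-1) 0 (by norm_num) (small 3 (by norm_num))]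
    exact sgn_odd _ (by decide)
  have n2 : ¬ (2 : ℤ) ∣ p := by
    intro hd
    have := (Nat.prime_dvd_prime_iff_eq Nat.prime_two hp).1 (by exact_mod_cast hd)
    omega
  have n3 : ¬ (3 : ℤ) ∣ p := by
    intro hd
    have := (Nat.prime_dvd_prime_iff_eq Nat.prime_three hp).1 (by exact_mod_cast hd)
    omega
  have hb : b % 2 = 1 := by
    by_contra hb
    obtain ⟨c, rfl⟩ : (2 : ℤ) ∣ b := by omega
    exact n2 ⟨a ^ 2 + a * c + 6 * c ^ 2, by rw [h]; ring⟩
  have ha : a % 2 = 0 := by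
    by_contra ha
    obtain ⟨c, rfl⟩ : ∃ c, b = 2 * c + 1 := ⟨b / 2, by omega⟩
    obtain ⟨d, rfl⟩ : ∃ d, a = 2 * d + 1 := ⟨a / 2, by omega⟩
    exact n2 ⟨(2 * d + 1) ^ 2 + (2 * d * c + c + d) + 6 * c ^ 2 + 6 * c + 2, by rw [h]; ring⟩
  have hab : ¬ (3 : ℤ) ∣ b - a := by
    rintro ⟨c, hc⟩
    obtain rfl : b = a + 3 * c := by linarith
    exact n3 ⟨2 * a ^ 2 + 7 * a * c + 9 * c ^ 2, by rw [h]; ring⟩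
  have hx : (5 * a + 7 * b) ^ 2 + 23 * (b - a) ^ 2 = 24 * (p : ℤ) := by rw [h]; ring
  have hu := fun j k hjk => uniq2 p hp (by omega) a b (6 * j - 1) (6 * k - 1) h ha hb hjk
  have : (b - a) % 6 = 1 ∨ (b - a) % 6 = 5 := by omega
  rcases this with h6 | h6
  · obtain ⟨k, hk⟩ : ∃ k, -(b - a) = 6 * k - 1 := ⟨(-(b - a) + 1) / 6, by omega⟩
    rw [single p hp.one_le (k - (a + b)) k]
    · apply sgn_odd
      rw [Int.odd_iff]; omega
    · rw [← hk, show 6 * (k - (a + b)) - 1 = - (5 * a + 7 * b) by linarith, ← hx]; ring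
    · intro j k' hjk
      have := hu j k' hjk
      omega
  · obtain ⟨k, hk⟩ : ∃ k, b - a = 6 * k - 1 := ⟨(b - a + 1) / 6, by omega⟩
    rw [single p hp.one_le (k + (a + b)) k]
    · apply sgn_odd
      rw [Int.odd_iff]; omega
    · rw [← hk, show 6 * (k + (a + b)) - 1 = (5 * a + 7 * b) by linarith, ← hx]
    · intro j k' hjk
      have := hu j k' hjk
      omega

lemma isSquare_neg (p : ℕ) (hp : p.Prime) (hp2 : p ≠ 2) (hp23 : p ≠ 23)
    (h : legendreSym 23 p ≠ -1) : ∃ t : ℤ, (p : ℤ) ∣ t ^ 2 + 23 := by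
  haveI : Fact p.Prime := ⟨hp⟩
  have hsq : IsSquare ((p : ℕ) : ZMod 23) := by
    by_contra hc
    exact h ((legendreSym.eq_neg_one_iff 23).2 (by simpa using hc))
  have key : IsSquare (-(23 : ZMod p)) := by
    have hodd : p % 2 = 1 := by
      rcases hp.eq_two_or_odd with h | h
      · exact absurd h hp2
      · exact h
    have : p % 4 = 1 ∨ p % 4 = 3 := by omega
    rcases this with h4 | h4
    · have h1 := (ZMod.exists_sq_eq_prime_iff_of_mod_four_eq_one (p := p) (q := 23) h4 (by norm_num)).2 hsq
      have h2 : IsSquare (-1 : ZMod p) := ZMod.exists_sq_eq_neg_one_iff.2 (by omega)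
      have := h2.mul h1
      simpa using this
    · have h1 := (ZMod.exists_sq_eq_prime_iff_of_mod_four_eq_three (p := p) (q := 23) h4 (by norm_num) hp23)
      by_contra hc
      have h23 : ((23 : ℤ) : ZMod p) ≠ 0 := by
        intro h0
        rw [ZMod.intCast_zmod_eq_zero_iff_dvd] at h0
        have := (Nat.prime_dvd_prime_iff_eq hp (by norm_num : Nat.Prime 23)).1 (by exact_mod_cast h0)
        exact hp23 this
      have l1 : legendreSym p (-23) = -1 := (legendreSym.eq_neg_one_iff p).2 (by simpa using hc)
      have l2 : legendreSym p (-1) = -1 := by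
        rw [legendreSym.eq_neg_one_iff]
        simp only [Int.cast_neg, Int.cast_one]
        rw [ZMod.exists_sq_eq_neg_one_iff]
        omega
      have l3 : legendreSym p 23 = 1 := by
        have : legendreSym p (-23) = legendreSym p (-1) * legendreSym p 23 := by
          rw [← legendreSym.mul]; norm_num
        rw [l1, l2] at this
        linarith
      rw [legendreSym.eq_one_iff p h23] at l3
      have l4 := legendreSym.quadratic_reciprocity_three_mod_four (p := p) (q := 23) h4 (by norm_num)
      have l3' : legendreSym p 23 = 1 := (legendreSym.eq_one_iff p h23).2 l3
      push_cast at l4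
      rw [l3'] at l4
      omega
  obtain ⟨r, hr⟩ := key
  obtain ⟨t, rfl⟩ := ZMod.intCast_surjective r
  refine ⟨t, ?_⟩
  rw [← ZMod.intCast_zmod_eq_zero_iff_dvd]
  push_cast
  linear_combination -hr

lemma represent (p : ℕ) (hp : p.Prime) (hp23 : p ≠ 23) (h : legendreSym 23 p ≠ -1)
    (hn : ¬ ∃ U V : ℤ, U ≠ 0 ∧ (p : ℤ) = U ^ 2 + 23 * V ^ 2) :
    ∃ a b : ℤ, (p : ℤ) = 2 * a ^ 2 + a * b + 3 * b ^ 2 := by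
  by_cases hp2 : p = 2
  · exact ⟨1, 0, by subst hp2; norm_num⟩
  obtain ⟨t, ht⟩ := isSquare_neg p hp hp2 hp23 h
  have hodd : p % 2 = 1 := by
    rcases hp.eq_two_or_odd with h | h
    · exact absurd h hp2
    · exact h
  obtain ⟨B, hB, hBp⟩ : ∃ B : ℤ, B % 2 = 1 ∧ (p : ℤ) ∣ B ^ 2 + 23 := by
    by_cases ho : t % 2 = 1
    · exact ⟨t, ho, ht⟩
    · refine ⟨t + p, by omega, ?_⟩
      have := dvd_add ht (Dvd.intro (2 * t + p) rfl : (p : ℤ) ∣ p * (2 * t + p))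
      rw [show (t + p : ℤ) ^ 2 + 23 = t ^ 2 + 23 + p * (2 * t + p) by ring]
      exact this
  have h4 : (4 : ℤ) ∣ B ^ 2 + 23 := by
    obtain ⟨c, rfl⟩ : ∃ c, B = 2 * c + 1 := ⟨B / 2, by omega⟩
    exact ⟨c ^ 2 + c + 6, by ring⟩
  have hcop : IsCoprime (4 : ℤ) p := by
    have : Nat.Coprime 4 p := by
      rw [show 4 = 2 ^ 2 by norm_num]
      apply Nat.Coprime.pow_left
      exact (Nat.coprime_primes Nat.prime_two hp).2 (Ne.symm hp2)
    exact_mod_cast Nat.isCoprime_iff_coprime.2 this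
  obtain ⟨C, hC⟩ := hcop.mul_dvd h4 hBp
  obtain ⟨α, β, γ, δ, hf⟩ := reduce p p B C (by exact_mod_cast hp.pos) le_rfl (by linarith)
  rcases hf with hf | hf
  · exfalso
    have h0 := hf 1 0
    simp only [mul_one, mul_zero, add_zero, one_pow, ne_eq, OfNat.ofNat_ne_zero,
      not_false_eq_true, zero_pow] at h0
    have hg : γ % 2 = 0 := by
      by_contra hg
      obtain ⟨c, rfl⟩ : ∃ c, γ = 2 * c + 1 := ⟨γ / 2, by omega⟩
      have ev : (2 : ℤ) ∣ α ^ 2 + α * (2 * c + 1) + 6 * (2 * c + 1) ^ 2 := by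
        obtain ⟨d, hd⟩ := Int.even_mul_succ_self α
        exact ⟨d + α * c + 3 * (2 * c + 1) ^ 2, by linear_combination hd⟩
      rw [← h0] at ev
      omega
    obtain ⟨c, rfl⟩ : ∃ c, γ = 2 * c := ⟨γ / 2, by omega⟩
    refine hn ⟨α + c, c, ?_, by rw [h0]; ring⟩
    intro hz
    obtain rfl : α = -c := by linarith
    have h5 : (p : ℤ) = 23 * c ^ 2 := by rw [h0]; ring
    have : (23 : ℤ) ∣ p := ⟨_, h5⟩
    exact hp23 ((Nat.prime_dvd_prime_iff_eq (by norm_num : Nat.Prime 23) hp).1 (by exact_mod_cast this)).symm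
  · refine ⟨α, γ, ?_⟩
    have h0 := hf 1 0
    linear_combination h0

lemma case_nonres (p : ℕ) (hp : p.Prime) (h : legendreSym 23 p = -1) :
    (ramanujanTau p : ZMod 23) = 0 := by
  rw [tau_sum p hp.one_le ∅]
  · simp
  · intro j k
    simp only [notMem_empty, false_iff]
    intro hjk
    rw [legendreSym.eq_neg_one_iff] at h
    apply h
    refine ⟨((6 * j - 1 : ℤ) : ZMod 23), ?_⟩
    have h1 : (((6 * j - 1) ^ 2 + 23 * (6 * k - 1) ^ 2 : ℤ) : ZMod 23) = ((24 * (p : ℤ) : ℤ) : ZMod 23) := by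
      rw [hjk]
    have h23 : (23 : ZMod 23) = 0 := by decide
    push_cast at h1 ⊢
    linear_combination (-1 : ZMod 23) * h1 + ((6 * k - 1) ^ 2 - p) * h23

end Wilton

/-- **Wilton's congruences** for `τ(p)` modulo 23. -/
theorem wilton_congruences (p : ℕ) (hp : p.Prime) :
    (p = 23 → ramanujanTau p ≡ 1 [ZMOD 23]) ∧
    (legendreSym 23 p = -1 → ramanujanTau p ≡ 0 [ZMOD 23]) ∧
    ((∃ U V : ℤ, U ≠ 0 ∧ (p : ℤ) = U ^ 2 + 23 * V ^ 2) →
      ramanujanTau p ≡ 2 [ZMOD 23]) ∧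
    (p ≠ 23 → legendreSym 23 p ≠ -1 →
      ¬ (∃ U V : ℤ, U ≠ 0 ∧ (p : ℤ) = U ^ 2 + 23 * V ^ 2) →
      ramanujanTau p ≡ -1 [ZMOD 23]) := by
  refine ⟨?_, ?_, ?_, ?_⟩
  · rintro rfl
    apply (ZMod.intCast_eq_intCast_iff _ _ 23).1
    rw [Wilton.single 23 (by norm_num) 4 0 (by norm_num) (Wilton.small 23 le_rfl),
      Wilton.sgn_even _ (by decide)]
    norm_num
  · intro h
    apply (ZMod.intCast_eq_intCast_iff _ _ 23).1
    rw [Wilton.case_nonres p hp h]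
    norm_num
  · rintro ⟨U, V, hU, h⟩
    apply (ZMod.intCast_eq_intCast_iff _ _ 23).1
    rw [Wilton.case_one p hp U V hU h]
    norm_num
  · intro h23 hl hn
    obtain ⟨a, b, h⟩ := Wilton.represent p hp h23 hl hn
    apply (ZMod.intCast_eq_intCast_iff _ _ 23).1
    rw [Wilton.case_two p hp a b h]
    norm_num
end

section
/- Define t_n = 1 if 23 ∤ τ(n) and t_n = 0 otherwise, and let T(s) = ∑_{n=1}^∞ t_n·n^{-s}. Let S₁ be the set of primes p that are quadratic non-residues modulo 23, let S₃ be the set of primes p that can be written as p = U² + 23·V² with integers U, V and U ≠ 0, and let S₂ be the set of all remaining primes p ≠ 23. Then for real s > 1, T(s) = (1 − 23^{-s})^{-1} · ∏_{p ∈ S₁} (1 − p^{-2s})^{-1} · ∏_{p ∈ S₂} (1 + p^{-s})/(1 − p^{-3s}) · ∏_{p ∈ S₃} (1 − p^{-22s})/((1 − p^{-s})(1 − p^{-23s})). -/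
open Finset

/-- `t n = 1` if `23 ∤ τ(n)`, and `t n = 0` otherwise. -/
noncomputable def t23 (n : ℕ) : ℝ := if (23 : ℤ) ∣ ramanujanTau n then 0 else 1

lemma dvd_cong {p a b : ℤ} (h : p ∣ a) (e : b = a) : p ∣ b := e ▸ h

def qa (v : ℤ × ℤ) : ℤ := v.1 ^ 2 + v.1 * v.2 + 6 * v.2 ^ 2

def qb (v : ℤ × ℤ) : ℤ := 2 * v.1 ^ 2 + v.1 * v.2 + 3 * v.2 ^ 2

lemma qa_fin (m : ℤ) : {v : ℤ × ℤ | qa v = m}.Finite := by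
  apply Set.Finite.subset ((Set.finite_Icc (-(2 * m)) (2 * m)).prod (Set.finite_Icc (-m) m))
  rintro ⟨x, y⟩ h
  simp only [Set.mem_ofPred_eq, qa] at h
  simp only [Set.mem_prod, Set.mem_Icc]
  have hx : 23 * x ^ 2 ≤ 24 * m := by nlinarith [sq_nonneg (x + 12 * y)]
  have hy : 23 * y ^ 2 ≤ 4 * m := by nlinarith [sq_nonneg (2 * x + y)]
  have := Int.le_self_sq x
  have := Int.le_self_sq y
  have := Int.le_self_sq (-x)
  have := Int.le_self_sq (-y)
  rw [neg_sq] at *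
  have := sq_nonneg x
  refine ⟨⟨?_, ?_⟩, ?_, ?_⟩ <;> linarith

lemma qb_fin (m : ℤ) : {v : ℤ × ℤ | qb v = m}.Finite := by
  apply Set.Finite.subset ((Set.finite_Icc (-m) m).prod (Set.finite_Icc (-m) m))
  rintro ⟨x, y⟩ h
  simp only [Set.mem_ofPred_eq, qb] at h
  simp only [Set.mem_prod, Set.mem_Icc]
  have hx : 23 * x ^ 2 ≤ 12 * m := by nlinarith [sq_nonneg (x + 6 * y)]
  have hy : 23 * y ^ 2 ≤ 8 * m := by nlinarith [sq_nonneg (4 * x + y)]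
  have := Int.le_self_sq x
  have := Int.le_self_sq y
  have := Int.le_self_sq (-x)
  have := Int.le_self_sq (-y)
  rw [neg_sq] at *
  have := sq_nonneg x
  refine ⟨⟨?_, ?_⟩, ?_, ?_⟩ <;> linarith

/-- number of representations -/
noncomputable def rn (q : ℤ × ℤ → ℤ) (m : ℤ) : ℤ := (Set.ncard {v : ℤ × ℤ | q v = m} : ℤ)

/-- the linear map with given matrix -/
def lm (a b c d : ℤ) (v : ℤ × ℤ) : ℤ × ℤ := (a * v.1 + b * v.2, c * v.1 + d * v.2)

lemma lm_inj (a b c d : ℤ) (h : a * d - b * c ≠ 0) : Function.Injective (lm a b c d) := by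
  rintro ⟨x, y⟩ ⟨z, w⟩ e
  simp only [lm, Prod.mk.injEq] at e
  obtain ⟨e1, e2⟩ := e
  ext
  · apply mul_left_cancel₀ h
    linear_combination d * e1 - b * e2
  · apply mul_left_cancel₀ h
    linear_combination a * e2 - c * e1

/-- the adjugate criterion -/
lemma lm_range (p : ℤ) (hp : p ≠ 0) (a b c d a' b' c' d' : ℤ)
    (h1 : a * a' + b * c' = p) (h2 : a * b' + b * d' = 0) (h3 : c * a' + d * c' = 0)
    (h4 : c * b' + d * d' = p) (x y : ℤ) (hx : p ∣ a' * x + b' * y) (hy : p ∣ c' * x + d' * y) :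
    ∃ w, (x, y) = lm a b c d w := by
  obtain ⟨u, hu⟩ := hx
  obtain ⟨v, hv⟩ := hy
  refine ⟨(u, v), ?_⟩
  simp only [lm, Prod.mk.injEq]
  constructor
  · apply mul_left_cancel₀ hp
    linear_combination -x * h1 - y * h2 + a * hu + b * hv
  · apply mul_left_cancel₀ hp
    linear_combination -x * h3 - y * h4 + c * hu + d * hv

lemma rn_one (q q' : ℤ × ℤ → ℤ) (p n : ℤ) (hp : p ≠ 0) (M : ℤ × ℤ → ℤ × ℤ)
    (hM : Function.Injective M) (h1 : ∀ w, q (M w) = p * q' w)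
    (h2 : ∀ v, p ∣ q v → ∃ w, v = M w) : rn q (p * n) = rn q' n := by
  have : {v | q v = p * n} = M '' {w | q' w = n} := by
    ext v
    simp only [Set.mem_ofPred_eq, Set.mem_image]
    constructor
    · intro h
      obtain ⟨w, rfl⟩ := h2 v ⟨n, h⟩
      exact ⟨w, mul_left_cancel₀ hp (by rw [← h1, h]), rfl⟩
    · rintro ⟨w, hw, rfl⟩
      rw [h1, hw]
  rw [rn, rn, this, Set.ncard_image_of_injective _ hM]

lemma rn_two (q q' q'' : ℤ × ℤ → ℤ) (p n : ℤ) (hp : p ≠ 0) (M M' : ℤ × ℤ → ℤ × ℤ)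
    (hf : {v | q v = p * n}.Finite)
    (hq : ∀ u, q (lm p 0 0 p u) = p * (p * q u))
    (hM : Function.Injective M) (hM' : Function.Injective M')
    (h1 : ∀ w, q (M w) = p * q' w) (h1' : ∀ w, q (M' w) = p * q'' w)
    (h2 : ∀ v, p ∣ q v → (∃ w, v = M w) ∨ ∃ w, v = M' w)
    (h3 : ∀ v, (∃ w, v = M w) → (∃ w, v = M' w) → ∃ u, v = lm p 0 0 p u)
    (h4 : ∀ u, (∃ w, lm p 0 0 p u = M w) ∧ ∃ w, lm p 0 0 p u = M' w) :
    rn q (p * n) + rn (fun v => p * q v) n = rn q' n + rn q'' n := by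
  have e1 : {v | q v = p * n} = M '' {w | q' w = n} ∪ M' '' {w | q'' w = n} := by
    ext v
    simp only [Set.mem_ofPred_eq, Set.mem_union, Set.mem_image]
    constructor
    · intro h
      obtain ⟨w, rfl⟩ | ⟨w, rfl⟩ := h2 v ⟨n, h⟩
      · exact Or.inl ⟨w, mul_left_cancel₀ hp (by rw [← h1, h]), rfl⟩
      · exact Or.inr ⟨w, mul_left_cancel₀ hp (by rw [← h1', h]), rfl⟩
    · rintro (⟨w, hw, rfl⟩ | ⟨w, hw, rfl⟩)
      · rw [h1, hw]
      · rw [h1', hw]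
  have e2 : M '' {w | q' w = n} ∩ M' '' {w | q'' w = n} = lm p 0 0 p '' {v | p * q v = n} := by
    ext v
    simp only [Set.mem_ofPred_eq, Set.mem_inter_iff, Set.mem_image]
    constructor
    · rintro ⟨⟨w, hw, rfl⟩, ⟨w', hw', e⟩⟩
      obtain ⟨u, hu⟩ := h3 _ ⟨w, rfl⟩ ⟨w', e.symm⟩
      refine ⟨u, ?_, hu.symm⟩
      apply mul_left_cancel₀ hp
      rw [← hq, ← hu, h1, hw]
    · rintro ⟨u, hu, rfl⟩
      obtain ⟨⟨w, hw⟩, ⟨w', hw'⟩⟩ := h4 u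
      refine ⟨⟨w, ?_, hw.symm⟩, ⟨w', ?_, hw'.symm⟩⟩
      · apply mul_left_cancel₀ hp
        rw [← h1, ← hw, hq, hu]
      · apply mul_left_cancel₀ hp
        rw [← h1', ← hw', hq, hu]
  have hf' := hf
  rw [e1, Set.finite_union] at hf'
  have := Set.ncard_union_add_ncard_inter _ _ hf'.1 hf'.2
  rw [e2, Set.ncard_image_of_injective _ hM, Set.ncard_image_of_injective _ hM',
    Set.ncard_image_of_injective _ (lm_inj p 0 0 p (by simp [hp])), ← e1] at this
  rw [rn, rn, rn, rn]
  exact_mod_cast this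

lemma qa_scale (p : ℤ) (u : ℤ × ℤ) : qa (lm p 0 0 p u) = p * (p * qa u) := by
  simp only [qa, lm]; ring

lemma qb_scale (p : ℤ) (u : ℤ × ℤ) : qb (lm p 0 0 p u) = p * (p * qb u) := by
  simp only [qb, lm]; ring

lemma lm_scale (p x y : ℤ) (hx : p ∣ x) (hy : p ∣ y) : ∃ u, (x, y) = lm p 0 0 p u := by
  obtain ⟨a, rfl⟩ := hx
  obtain ⟨b, rfl⟩ := hy
  exact ⟨(a, b), by simp [lm]⟩

/-- two linear maps with adjugates; abstract form specialised to matrices -/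
lemma rn_mat (q q' q'' : ℤ × ℤ → ℤ) (p n : ℤ) (hp : p ≠ 0)
    (a b c d a' b' c' d' e f g h e' f' g' h' : ℤ)
    (hf : {v | q v = p * n}.Finite)
    (hq : ∀ u, q (lm p 0 0 p u) = p * (p * q u))
    (A1 : a * a' + b * c' = p) (A2 : a * b' + b * d' = 0) (A3 : c * a' + d * c' = 0)
    (A4 : c * b' + d * d' = p)
    (A1' : a' * a + b' * c = p) (A2' : a' * b + b' * d = 0) (A3' : c' * a + d' * c = 0)
    (A4' : c' * b + d' * d = p)
    (B1 : e * e' + f * g' = p) (B2 : e * f' + f * h' = 0) (B3 : g * e' + h * g' = 0)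
    (B4 : g * f' + h * h' = p)
    (B1' : e' * e + f' * g = p) (B2' : e' * f + f' * h = 0) (B3' : g' * e + h' * g = 0)
    (B4' : g' * f + h' * h = p)
    (h1 : ∀ w, q (lm a b c d w) = p * q' w) (h1' : ∀ w, q (lm e f g h w) = p * q'' w)
    (h2 : ∀ x y, p ∣ q (x, y) → (p ∣ a' * x + b' * y ∧ p ∣ c' * x + d' * y) ∨
      (p ∣ e' * x + f' * y ∧ p ∣ g' * x + h' * y))
    (h3 : ∀ x y, p ∣ a' * x + b' * y → p ∣ c' * x + d' * y → p ∣ e' * x + f' * y →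
      p ∣ g' * x + h' * y → p ∣ x ∧ p ∣ y) :
    rn q (p * n) + rn (fun v => p * q v) n = rn q' n + rn q'' n := by
  have key : ∀ a b c d a' b' c' d' : ℤ, a' * a + b' * c = p → a' * b + b' * d = 0 →
      c' * a + d' * c = 0 → c' * b + d' * d = p → Function.Injective (lm a b c d) := by
    intro a b c d a' b' c' d' A1' A2' A3' A4'
    apply lm_inj
    intro h0
    have : (a * d - b * c) * (a' * d' - b' * c') = p * p := by
      linear_combination (c' * b + d' * d) * A1' + p * A4' - (c' * a + d' * c) * A2'
    rw [h0, zero_mul] at this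
    exact hp (by simpa using this.symm)
  have kd : ∀ a b c d a' b' c' d' : ℤ, a' * a + b' * c = p → a' * b + b' * d = 0 →
      c' * a + d' * c = 0 → c' * b + d' * d = p → ∀ x y w, (x, y) = lm a b c d w →
      p ∣ a' * x + b' * y ∧ p ∣ c' * x + d' * y := by
    rintro a b c d a' b' c' d' A1' A2' A3' A4' x y ⟨u, v⟩ e
    simp only [lm, Prod.mk.injEq] at e
    obtain ⟨rfl, rfl⟩ := e
    exact ⟨⟨u, by linear_combination u * A1' + v * A2'⟩, ⟨v, by linear_combination u * A3' + v * A4'⟩⟩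
  refine rn_two q q' q'' p n hp (lm a b c d) (lm e f g h) hf hq (key _ _ _ _ _ _ _ _ A1' A2' A3' A4')
    (key _ _ _ _ _ _ _ _ B1' B2' B3' B4') h1 h1' ?_ ?_ ?_
  · rintro ⟨x, y⟩ hv
    rcases h2 x y hv with ⟨i, j⟩ | ⟨i, j⟩
    · exact Or.inl (lm_range p hp a b c d a' b' c' d' A1 A2 A3 A4 x y i j)
    · exact Or.inr (lm_range p hp e f g h e' f' g' h' B1 B2 B3 B4 x y i j)
  · rintro ⟨x, y⟩ ⟨w, hw⟩ ⟨w', hw'⟩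
    obtain ⟨i, j⟩ := kd _ _ _ _ _ _ _ _ A1' A2' A3' A4' x y w hw
    obtain ⟨i', j'⟩ := kd _ _ _ _ _ _ _ _ B1' B2' B3' B4' x y w' hw'
    obtain ⟨k, l⟩ := h3 x y i j i' j'
    exact lm_scale p x y k l
  · rintro ⟨x, y⟩
    have z1 : ∀ t : ℤ × ℤ, p ∣ (lm p 0 0 p t).1 ∧ p ∣ (lm p 0 0 p t).2 := by
      intro t; simp [lm]
    obtain ⟨i, j⟩ := z1 (x, y)
    constructor
    · exact lm_range p hp a b c d a' b' c' d' A1 A2 A3 A4 _ _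
        (dvd_add (i.mul_left _) (j.mul_left _)) (dvd_add (i.mul_left _) (j.mul_left _))
    · exact lm_range p hp e f g h e' f' g' h' B1 B2 B3 B4 _ _
        (dvd_add (i.mul_left _) (j.mul_left _)) (dvd_add (i.mul_left _) (j.mul_left _))

lemma prime_odd_dvd {p : ℕ} (hp : p.Prime) (h2 : p ≠ 2) {x : ℤ} (h : (p : ℤ) ∣ 2 * x) :
    (p : ℤ) ∣ x := by
  have hp' := Nat.prime_iff_prime_int.mp hp
  rcases hp'.dvd_or_dvd h with h | h
  · exfalso
    have h : p ∣ 2 := by exact_mod_cast h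
    exact h2 ((Nat.prime_dvd_prime_iff_eq hp Nat.prime_two).mp h)
  · exact h

lemma prime_23_dvd {p : ℕ} (hp : p.Prime) (h2 : p ≠ 23) {x : ℤ} (h : (p : ℤ) ∣ 23 * x) :
    (p : ℤ) ∣ x := by
  have hp' := Nat.prime_iff_prime_int.mp hp
  rcases hp'.dvd_or_dvd h with h | h
  · exfalso
    have h : p ∣ 23 := by exact_mod_cast h
    exact h2 ((Nat.prime_dvd_prime_iff_eq hp (by norm_num)).mp h)
  · exact h

lemma dvd_sq_small {p : ℤ} (_hp : 0 < p) {x : ℤ} (h : p ∣ x) (hx : x ≠ 0) : p * p ≤ x ^ 2 := by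
  obtain ⟨k, rfl⟩ := h
  have hk : k ≠ 0 := by rintro rfl; simp at hx
  have : 0 < k ^ 2 := by positivity
  nlinarith [mul_self_nonneg p]

/-- facts for principal primes -/
lemma princ_facts {p : ℕ} (hp : p.Prime) {U V : ℤ} (hU : U ≠ 0) (h : (p : ℤ) = U ^ 2 + 23 * V ^ 2) :
    p ≠ 2 ∧ ¬ (p : ℤ) ∣ U ∧ ¬ (p : ℤ) ∣ V := by
  have hV : V ≠ 0 := by
    rintro rfl
    have := Nat.prime_iff_prime_int.mp hp
    rw [h] at this
    have e : U ^ 2 + 23 * 0 ^ 2 = U * U := by ring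
    rw [e] at this
    have h3 := this.irreducible.isUnit_or_isUnit rfl
    have h4 : IsUnit U := by tauto
    exact this.not_isUnit (h4.mul h4)
  have u0 : 0 < U ^ 2 := by positivity
  have v0 : 0 < V ^ 2 := by positivity
  have p0 : (0 : ℤ) < p := by exact_mod_cast hp.pos
  refine ⟨?_, fun hd => ?_, fun hd => ?_⟩
  · rintro rfl; push_cast at h; nlinarith
  · have := dvd_sq_small p0 hd hU; nlinarith
  · have := dvd_sq_small p0 hd hV; nlinarith

lemma princ_a {p : ℕ} (hp : p.Prime) {U V : ℤ} (hU : U ≠ 0) (h : (p : ℤ) = U ^ 2 + 23 * V ^ 2)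
    (n : ℤ) : rn qa (p * n) + rn (fun v => p * qa v) n = rn qa n + rn qa n := by
  obtain ⟨hp2, hpU, hpV⟩ := princ_facts hp hU h
  have hp' := Nat.prime_iff_prime_int.mp hp
  refine rn_mat qa qa qa p n hp'.ne_zero (U - V) (-12 * V) (2 * V) (U + V)
    (U + V) (12 * V) (-2 * V) (U - V) (U + V) (12 * V) (-2 * V) (U - V)
    (U - V) (-12 * V) (2 * V) (U + V) (qa_fin _) (qa_scale _) ?_ ?_ ?_ ?_ ?_ ?_ ?_ ?_ ?_ ?_ ?_ ?_ ?_ ?_ ?_ ?_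
    ?_ ?_ ?_ ?_
  all_goals try ring1
  all_goals try (rw [h]; ring1)
  any_goals (intro w; simp only [qa, lm]; rw [h]; ring1)
  · intro x y hd
    have e : (-2 * V * x + (U - V) * y) * (2 * V * x + (U + V) * y)
        = p * y ^ 2 - 4 * V ^ 2 * qa (x, y) := by
      simp only [qa]; rw [h]; ring
    have : (p : ℤ) ∣ (-2 * V * x + (U - V) * y) * (2 * V * x + (U + V) * y) := by
      rw [e]; exact dvd_sub (dvd_mul_right _ _) (hd.mul_left _)
    rcases hp'.dvd_or_dvd this with hs | hs
    · left
      refine ⟨?_, hs⟩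
      apply prime_odd_dvd hp hp2
      refine (hp'.dvd_or_dvd (?_ : (p : ℤ) ∣ V * _)).resolve_left hpV
      have : V * (2 * ((U + V) * x + 12 * V * y)) = p * y - (U + V) * (-2 * V * x + (U - V) * y) := by
        rw [h]; ring
      rw [this]; exact dvd_sub (dvd_mul_right _ _) (hs.mul_left _)
    · right
      refine ⟨?_, hs⟩
      apply prime_odd_dvd hp hp2
      refine (hp'.dvd_or_dvd (?_ : (p : ℤ) ∣ V * _)).resolve_left hpV
      have : V * (2 * ((U - V) * x + -12 * V * y)) = (U - V) * (2 * V * x + (U + V) * y) - p * y := by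
        rw [h]; ring
      rw [this]; exact dvd_sub (hs.mul_left _) (dvd_mul_right _ _)
  · intro x y i j k l
    constructor
    · refine (hp'.dvd_or_dvd (?_ : (p : ℤ) ∣ U * _)).resolve_left hpU
      apply prime_odd_dvd hp hp2
      exact dvd_cong (dvd_add i k) (by ring)
    · refine (hp'.dvd_or_dvd (?_ : (p : ℤ) ∣ U * _)).resolve_left hpU
      apply prime_odd_dvd hp hp2
      exact dvd_cong (dvd_add j l) (by ring)

lemma princ_b {p : ℕ} (hp : p.Prime) {U V : ℤ} (hU : U ≠ 0) (h : (p : ℤ) = U ^ 2 + 23 * V ^ 2)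
    (n : ℤ) : rn qb (p * n) + rn (fun v => p * qb v) n = rn qb n + rn qb n := by
  obtain ⟨hp2, hpU, hpV⟩ := princ_facts hp hU h
  have hp' := Nat.prime_iff_prime_int.mp hp
  refine rn_mat qb qb qb p n hp'.ne_zero (U - V) (-6 * V) (4 * V) (U + V)
    (U + V) (6 * V) (-4 * V) (U - V) (U + V) (6 * V) (-4 * V) (U - V)
    (U - V) (-6 * V) (4 * V) (U + V) (qb_fin _) (qb_scale _) ?_ ?_ ?_ ?_ ?_ ?_ ?_ ?_ ?_ ?_ ?_ ?_ ?_ ?_ ?_ ?_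
    ?_ ?_ ?_ ?_
  all_goals try ring1
  all_goals try (rw [h]; ring1)
  any_goals (intro w; simp only [qb, lm]; rw [h]; ring1)
  · intro x y hd
    have e : (-4 * V * x + (U - V) * y) * (4 * V * x + (U + V) * y)
        = p * y ^ 2 - 8 * V ^ 2 * qb (x, y) := by
      simp only [qb]; rw [h]; ring
    have : (p : ℤ) ∣ (-4 * V * x + (U - V) * y) * (4 * V * x + (U + V) * y) := by
      rw [e]; exact dvd_sub (dvd_mul_right _ _) (hd.mul_left _)
    rcases hp'.dvd_or_dvd this with hs | hs
    · left
      refine ⟨?_, hs⟩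
      apply prime_odd_dvd hp hp2
      apply prime_odd_dvd hp hp2
      refine (hp'.dvd_or_dvd (?_ : (p : ℤ) ∣ V * _)).resolve_left hpV
      have : V * (2 * (2 * ((U + V) * x + 6 * V * y))) = p * y - (U + V) * (-4 * V * x + (U - V) * y) := by
        rw [h]; ring
      rw [this]; exact dvd_sub (dvd_mul_right _ _) (hs.mul_left _)
    · right
      refine ⟨?_, hs⟩
      apply prime_odd_dvd hp hp2
      apply prime_odd_dvd hp hp2
      refine (hp'.dvd_or_dvd (?_ : (p : ℤ) ∣ V * _)).resolve_left hpV
      have : V * (2 * (2 * ((U - V) * x + -6 * V * y))) = (U - V) * (4 * V * x + (U + V) * y) - p * y := by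
        rw [h]; ring
      rw [this]; exact dvd_sub (hs.mul_left _) (dvd_mul_right _ _)
  · intro x y i j k l
    constructor
    · refine (hp'.dvd_or_dvd (?_ : (p : ℤ) ∣ U * _)).resolve_left hpU
      apply prime_odd_dvd hp hp2
      exact dvd_cong (dvd_add i k) (by ring)
    · refine (hp'.dvd_or_dvd (?_ : (p : ℤ) ∣ U * _)).resolve_left hpU
      apply prime_odd_dvd hp hp2
      exact dvd_cong (dvd_add j l) (by ring)

lemma nonpr_facts {p : ℕ} (hp : p.Prime) (hp2 : p ≠ 2) {a b : ℤ} (h : (p : ℤ) = qb (a, b)) :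
    ¬ (p : ℤ) ∣ b := by
  have p0 : (0 : ℤ) < p := by exact_mod_cast hp.pos
  simp only [qb] at h
  have hb : b ≠ 0 := by
    rintro rfl
    have : (2 : ℤ) ∣ p := ⟨a ^ 2, by rw [h]; ring⟩
    have : 2 ∣ p := by exact_mod_cast this
    exact hp2 ((Nat.prime_dvd_prime_iff_eq Nat.prime_two hp).mp this).symm
  intro hd
  have := dvd_sq_small p0 hd hb
  nlinarith [sq_nonneg (4 * a + b)]

lemma nonpr_a {p : ℕ} (hp : p.Prime) (hp23 : p ≠ 23) {a b : ℤ}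
    (h : (p : ℤ) = qb (a, b)) (hp2 : p = 2 → a = 1 ∧ b = 0)
    (n : ℤ) : rn qa (p * n) + rn (fun v => p * qa v) n = rn qb n + rn qb n := by
  have hp' := Nat.prime_iff_prime_int.mp hp
  have h' := h
  simp only [qb] at h'
  refine rn_mat qa qb qb p n hp'.ne_zero (2 * a + b) (3 * b) (-b) a a (-3 * b) b (2 * a + b)
    (2 * a) (a + 3 * b) b (-a) a (a + 3 * b) b (-2 * a)
    (qa_fin _) (qa_scale _) ?_ ?_ ?_ ?_ ?_ ?_ ?_ ?_ ?_ ?_ ?_ ?_ ?_ ?_ ?_ ?_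
    ?_ ?_ ?_ ?_
  all_goals try ring1
  all_goals try (rw [h']; ring1)
  any_goals (intro w; simp only [qa, qb, lm]; rw [h']; ring1)
  · intro x y hd
    by_cases hp3 : p = 2
    · obtain ⟨rfl, rfl⟩ := hp2 hp3
      subst hp3
      simp only [qa] at hd
      have : (2 : ℤ) ∣ x * (x + y) := by
        have := dvd_sub hd (Dvd.intro (3 * y ^ 2) rfl)
        exact dvd_cong this (by push_cast; ring)
      rcases Int.prime_two.dvd_or_dvd this with hh | hh
      · left; push_cast; constructor <;> omega
      · right; push_cast; constructor <;> omega
    have hb := nonpr_facts hp hp3 h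
    have e : (b * x + (2 * a + b) * y) * (b * x + -2 * a * y) = b ^ 2 * qa (x, y) - p * (2 * y ^ 2) := by
      simp only [qa]; rw [h']; ring
    have : (p : ℤ) ∣ (b * x + (2 * a + b) * y) * (b * x + -2 * a * y) := by
      rw [e]; exact dvd_sub (hd.mul_left _) (dvd_mul_right _ _)
    rcases hp'.dvd_or_dvd this with hs | hs
    · left
      refine ⟨?_, hs⟩
      refine (hp'.dvd_or_dvd (?_ : (p : ℤ) ∣ b * _)).resolve_left hb
      have : b * (a * x + -3 * b * y) = a * (b * x + (2 * a + b) * y) - p * y := by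
        rw [h']; ring
      rw [this]; exact dvd_sub (hs.mul_left _) (dvd_mul_right _ _)
    · right
      refine ⟨?_, hs⟩
      refine (hp'.dvd_or_dvd (?_ : (p : ℤ) ∣ b * _)).resolve_left hb
      have : b * (a * x + (a + 3 * b) * y) = a * (b * x + -2 * a * y) + p * y := by
        rw [h']; ring
      rw [this]; exact dvd_add (hs.mul_left _) (dvd_mul_right _ _)
  · intro x y i j k l
    by_cases hp3 : p = 2
    · obtain ⟨rfl, rfl⟩ := hp2 hp3
      subst hp3
      push_cast at *
      omega
    have hb := nonpr_facts hp hp3 h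
    have h4 : ¬ (p : ℤ) ∣ 4 * a + b := by
      intro hd
      apply hb
      apply hp'.dvd_of_dvd_pow (n := 2)
      apply prime_23_dvd hp hp23
      have : 23 * b ^ 2 = p * 8 - (4 * a + b) * (4 * a + b) := by rw [h']; ring
      rw [this]
      exact dvd_sub (dvd_mul_right _ _) (hd.mul_left _)
    have hy : (p : ℤ) ∣ y := by
      refine (hp'.dvd_or_dvd (?_ : (p : ℤ) ∣ (4 * a + b) * _)).resolve_left h4
      exact dvd_cong (dvd_sub j l) (by ring)
    refine ⟨?_, hy⟩
    refine (hp'.dvd_or_dvd (?_ : (p : ℤ) ∣ b * _)).resolve_left hb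
    have : b * x = (b * x + -2 * a * y) + y * (2 * a) := by ring
    rw [this]
    exact dvd_add l (hy.mul_right _)

lemma nonpr_b {p : ℕ} (hp : p.Prime) (hp23 : p ≠ 23) {a b : ℤ}
    (h : (p : ℤ) = qb (a, b)) (hp2 : p = 2 → a = 1 ∧ b = 0)
    (n : ℤ) : rn qb (p * n) + rn (fun v => p * qb v) n = rn qa n + rn qb n := by
  have hp' := Nat.prime_iff_prime_int.mp hp
  have h' := h
  simp only [qb] at h'
  refine rn_mat qb qa qb p n hp'.ne_zero a (-3 * b) b (2 * a + b) (2 * a + b) (3 * b) (-b) a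
    (a - b) (-(a + 2 * b)) (-(a + b)) (-(a - b)) (a - b) (-(a + 2 * b)) (-(a + b)) (-(a - b))
    (qb_fin _) (qb_scale _) ?_ ?_ ?_ ?_ ?_ ?_ ?_ ?_ ?_ ?_ ?_ ?_ ?_ ?_ ?_ ?_
    ?_ ?_ ?_ ?_
  all_goals try ring1
  all_goals try (rw [h']; ring1)
  any_goals (intro w; simp only [qa, qb, lm]; rw [h']; ring1)
  · intro x y hd
    by_cases hp3 : p = 2
    · obtain ⟨rfl, rfl⟩ := hp2 hp3
      subst hp3
      simp only [qb] at hd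
      have : (2 : ℤ) ∣ y * (x + y) := by
        have := dvd_sub hd (Dvd.intro (x ^ 2 + y ^ 2) rfl)
        exact dvd_cong this (by push_cast; ring)
      rcases Int.prime_two.dvd_or_dvd this with hh | hh
      · left; push_cast; constructor <;> omega
      · right; push_cast; constructor <;> omega
    have hb := nonpr_facts hp hp3 h
    have hab : ¬ (p : ℤ) ∣ a + b := by
      intro hd
      apply hb
      apply hp'.dvd_of_dvd_pow (n := 2)
      apply prime_odd_dvd hp hp3
      apply prime_odd_dvd hp hp3
      have : 2 * (2 * b ^ 2) = p - (2 * a - b) * (a + b) := by rw [h']; ring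
      rw [this]
      exact dvd_sub (dvd_refl _) (hd.mul_left _)
    have e : 2 * ((-b * x + a * y) * (-(a + b) * x + -(a - b) * y)) =
       (a * b + b ^ 2) * qb (x, y) - p * (x * y + y ^ 2) := by
      simp only [qb]; rw [h']; ring
    have : (p : ℤ) ∣ (-b * x + a * y) * (-(a + b) * x + -(a - b) * y) := by
      apply prime_odd_dvd hp hp3
      rw [e]; exact dvd_sub (hd.mul_left _) (dvd_mul_right _ _)
    rcases hp'.dvd_or_dvd this with hs | hs
    · left
      refine ⟨?_, hs⟩
      refine (hp'.dvd_or_dvd (?_ : (p : ℤ) ∣ b * _)).resolve_left hb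
      have : b * ((2 * a + b) * x + 3 * b * y) = p * y - (2 * a + b) * (-b * x + a * y) := by
        rw [h']; ring
      rw [this]; exact dvd_sub (dvd_mul_right _ _) (hs.mul_left _)
    · right
      refine ⟨?_, hs⟩
      refine (hp'.dvd_or_dvd (?_ : (p : ℤ) ∣ (a + b) * _)).resolve_left hab
      have : (a + b) * ((a - b) * x + -(a + 2 * b) * y) = -(a - b) * (-(a + b) * x + -(a - b) * y) - p * y := by
        rw [h']; ring
      rw [this]; exact dvd_sub (hs.mul_left _) (dvd_mul_right _ _)
  · intro x y i j k l
    by_cases hp3 : p = 2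
    · obtain ⟨rfl, rfl⟩ := hp2 hp3
      subst hp3
      push_cast at *
      omega
    have hb := nonpr_facts hp hp3 h
    have h4 : ¬ (p : ℤ) ∣ 3 * a - 5 * b := by
      intro hd
      apply hb
      apply hp'.dvd_of_dvd_pow (n := 2)
      apply prime_23_dvd hp hp23
      apply prime_odd_dvd hp hp3
      apply prime_odd_dvd hp hp3
      have : 2 * (2 * (23 * b ^ 2)) = p * 9 - (6 * a + 13 * b) * (3 * a - 5 * b) := by rw [h']; ring
      rw [this]
      exact dvd_sub (dvd_mul_right _ _) (hd.mul_left _)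
    have hy : (p : ℤ) ∣ y := by
      refine (hp'.dvd_or_dvd (?_ : (p : ℤ) ∣ (3 * a - 5 * b) * _)).resolve_left h4
      refine (hp'.dvd_or_dvd (?_ : (p : ℤ) ∣ b * _)).resolve_left hb
      have : b * ((3 * a - 5 * b) * y) = (-2 * b) * (-(a + b) * x + -(a - b) * y)
        + (2 * (a + b)) * (-b * x + a * y) - p * y := by rw [h']; ring
      rw [this]
      exact dvd_sub (dvd_add (l.mul_left _) (j.mul_left _)) (dvd_mul_right _ _)
    refine ⟨?_, hy⟩
    refine (hp'.dvd_or_dvd (?_ : (p : ℤ) ∣ b * _)).resolve_left hb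
    have : b * x = y * a - (-b * x + a * y) := by ring
    rw [this]
    exact dvd_sub (hy.mul_right _) j

lemma ram_a (n : ℤ) : rn qa (23 * n) = rn qa n := by
  refine rn_one qa qa 23 n (by norm_num) (lm (-1) (-12) 2 1) (lm_inj _ _ _ _ (by norm_num)) ?_ ?_
  · intro w; simp only [qa, lm]; ring
  · rintro ⟨x, y⟩ h
    have h23 : Prime (23 : ℤ) := Int.prime_iff_natAbs_prime.mpr (by norm_num)
    have : (23 : ℤ) ∣ 2 * x + y := by
      apply h23.dvd_of_dvd_pow (n := 2)
      have e : (2 * x + y) ^ 2 = 4 * qa (x, y) - 23 * y ^ 2 := by simp only [qa]; ring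
      rw [e]; exact dvd_sub (h.mul_left _) (dvd_mul_right _ _)
    apply lm_range 23 (by norm_num) _ _ _ _ 1 12 (-2) (-1) <;> omega

lemma ram_b (n : ℤ) : rn qb (23 * n) = rn qb n := by
  refine rn_one qb qb 23 n (by norm_num) (lm (-1) (-6) 4 1) (lm_inj _ _ _ _ (by norm_num)) ?_ ?_
  · intro w; simp only [qb, lm]; ring
  · rintro ⟨x, y⟩ h
    have h23 : Prime (23 : ℤ) := Int.prime_iff_natAbs_prime.mpr (by norm_num)
    have : (23 : ℤ) ∣ 4 * x + y := by
      apply h23.dvd_of_dvd_pow (n := 2)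
      have e : (4 * x + y) ^ 2 = 8 * qb (x, y) - 23 * y ^ 2 := by simp only [qb]; ring
      rw [e]; exact dvd_sub (h.mul_left _) (dvd_mul_right _ _)
    apply lm_range 23 (by norm_num) _ _ _ _ 1 6 (-4) (-1) <;> omega

lemma inert_gen {p : ℕ} (hp : p.Prime) (hp2 : p ≠ 2) (hns : ∀ z : ZMod p, z ^ 2 ≠ -23) (x y : ℤ)
    (h : (p : ℤ) ∣ x ^ 2 + 23 * y ^ 2) : (p : ℤ) ∣ x ∧ (p : ℤ) ∣ y := by
  have : Fact p.Prime := ⟨hp⟩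
  rw [← ZMod.intCast_zmod_eq_zero_iff_dvd] at h
  rw [← ZMod.intCast_zmod_eq_zero_iff_dvd, ← ZMod.intCast_zmod_eq_zero_iff_dvd]
  push_cast at h
  have hy : (y : ZMod p) = 0 := by
    by_contra hy
    apply hns (x / y)
    field_simp
    linear_combination h
  rw [hy] at h
  exact ⟨by simpa using h, hy⟩

lemma inert_a {p : ℕ} (hp : p.Prime) (hp2 : p ≠ 2) (hns : ∀ z : ZMod p, z ^ 2 ≠ -23) (n : ℤ) :
    rn qa (p * n) = rn (fun v => p * qa v) n := by
  have hp0 : (p : ℤ) ≠ 0 := by exact_mod_cast hp.ne_zero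
  refine rn_one qa _ p n hp0 (lm p 0 0 p) (lm_inj _ _ _ _ (by simpa using hp0)) (qa_scale _) ?_
  rintro ⟨x, y⟩ h
  obtain ⟨h1, h2⟩ := inert_gen hp hp2 hns (2 * x + y) y (by
    have e : (2 * x + y) ^ 2 + 23 * y ^ 2 = 4 * qa (x, y) := by simp only [qa]; ring
    rw [e]; exact h.mul_left _)
  refine lm_scale _ _ _ (prime_odd_dvd hp hp2 ?_) h2
  exact dvd_cong (dvd_sub h1 h2) (by ring)

lemma inert_b {p : ℕ} (hp : p.Prime) (hp2 : p ≠ 2) (hns : ∀ z : ZMod p, z ^ 2 ≠ -23) (n : ℤ) :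
    rn qb (p * n) = rn (fun v => p * qb v) n := by
  have hp0 : (p : ℤ) ≠ 0 := by exact_mod_cast hp.ne_zero
  refine rn_one qb _ p n hp0 (lm p 0 0 p) (lm_inj _ _ _ _ (by simpa using hp0)) (qb_scale _) ?_
  rintro ⟨x, y⟩ h
  obtain ⟨h1, h2⟩ := inert_gen hp hp2 hns (4 * x + y) y (by
    have e : (4 * x + y) ^ 2 + 23 * y ^ 2 = 8 * qb (x, y) := by simp only [qb]; ring
    rw [e]; exact h.mul_left _)
  refine lm_scale _ _ _ (prime_odd_dvd hp hp2 (prime_odd_dvd hp hp2 ?_)) h2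
  exact dvd_cong (dvd_sub h1 h2) (by ring)

lemma reduce_form : ∀ N : ℕ, ∀ A B C : ℤ, 0 < A → A ≤ N → B ^ 2 - 4 * A * C = -23 →
    (∀ x y : ℤ, ∃ v, qa v = A * x ^ 2 + B * x * y + C * y ^ 2) ∨
    (∀ x y : ℤ, ∃ v, qb v = A * x ^ 2 + B * x * y + C * y ^ 2) := by
  intro N
  induction N with
  | zero => intro A B C h1 h2; push_cast at h2; omega
  | succ N ih =>
    intro A B C hA hN hD
    obtain ⟨k, hk1, hk2⟩ : ∃ k : ℤ, -A ≤ B - 2 * A * k ∧ B - 2 * A * k ≤ A := by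
      refine ⟨(B + A) / (2 * A), ?_, ?_⟩
      · have := Int.ediv_mul_le (B + A) (show 2 * A ≠ 0 by omega)
        nlinarith
      · have := Int.lt_ediv_add_one_mul_self (B + A) (show 0 < 2 * A by omega)
        nlinarith
    obtain ⟨B', hB'⟩ : ∃ B', B' = B - 2 * A * k := ⟨_, rfl⟩
    obtain ⟨C', hC'⟩ : ∃ C', C' = C + A * k ^ 2 - B * k := ⟨_, rfl⟩
    rw [← hB'] at hk1 hk2
    have hD' : B' ^ 2 - 4 * A * C' = -23 := by rw [hB', hC']; linear_combination hD
    have hval : ∀ x y : ℤ, A * x ^ 2 + B * x * y + C * y ^ 2 =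
        A * (x + k * y) ^ 2 + B' * (x + k * y) * y + C' * y ^ 2 := by
      intro x y; rw [hB', hC']; ring
    have hCpos : 0 < C' := by nlinarith [sq_nonneg B']
    by_cases hlt : C' < A
    · rcases ih C' (-B') A hCpos (by push_cast at hN; omega) (by linear_combination hD') with h | h
      · left; intro x y
        obtain ⟨v, hv⟩ := h y (-(x + k * y))
        exact ⟨v, by rw [hv, hval]; ring⟩
      · right; intro x y
        obtain ⟨v, hv⟩ := h y (-(x + k * y))
        exact ⟨v, by rw [hv, hval]; ring⟩
    · push Not at hlt
      have hA2 : A ≤ 2 := by nlinarith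
      have hAA : A = 1 ∨ A = 2 := by omega
      rcases hAA with rfl | rfl
      · left
        have hB1 : B' = 1 ∨ B' = -1 := by
          have : B' = -1 ∨ B' = 0 ∨ B' = 1 := by omega
          rcases this with h | h | h <;> subst h <;> omega
        rcases hB1 with h | h <;> subst h <;> intro x y
        · have : C' = 6 := by omega
          exact ⟨(x + k * y, y), by rw [hval, this]; simp only [qa]; ring⟩
        · have : C' = 6 := by omega
          exact ⟨(x + k * y, -y), by rw [hval, this]; simp only [qa]; ring⟩
      · right
        have hB1 : B' = 1 ∨ B' = -1 := by
          have : B' = -1 ∨ B' = 0 ∨ B' = 1 ∨ B' = -2 ∨ B' = 2 := by omega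
          rcases this with h | h | h | h | h <;> subst h <;> omega
        rcases hB1 with h | h <;> subst h <;> intro x y
        · have : C' = 3 := by omega
          exact ⟨(x + k * y, y), by rw [hval, this]; simp only [qb]; ring⟩
        · have : C' = 3 := by omega
          exact ⟨(x + k * y, -y), by rw [hval, this]; simp only [qb]; ring⟩

lemma split_rep {p : ℕ} (hp : p.Prime) (hp2 : p ≠ 2) (z : ZMod p) (hz : z ^ 2 = -23) :
    (∃ v, qa v = p) ∨ ∃ v, qb v = p := by
  have : Fact p.Prime := ⟨hp⟩
  have hodd : p % 2 = 1 := hp.eq_two_or_odd.resolve_left hp2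
  obtain ⟨b, hb, hb2⟩ : ∃ b : ℤ, (p : ℤ) ∣ b ^ 2 + 23 ∧ b % 2 = 1 := by
    have h0 : ∀ w : ℤ, (w : ZMod p) = z → (p : ℤ) ∣ w ^ 2 + 23 := by
      intro w hw
      rw [← ZMod.intCast_zmod_eq_zero_iff_dvd]
      push_cast
      rw [hw, hz]; ring
    rcases Int.emod_two_eq_zero_or_one (z.val : ℤ) with h | h
    · exact ⟨z.val + p, h0 _ (by simp), by omega⟩
    · exact ⟨z.val, h0 _ (by simp), h⟩
  have h4 : (4 : ℤ) ∣ b ^ 2 + 23 := by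
    obtain ⟨k, hk⟩ : ∃ k, b = 2 * k + 1 := ⟨b / 2, by omega⟩
    exact ⟨k ^ 2 + k + 6, by rw [hk]; ring⟩
  have hcop : IsCoprime (4 : ℤ) p := by
    rw [Int.isCoprime_iff_gcd_eq_one]
    have : Nat.Coprime 4 p := by
      have : Nat.Coprime 2 p := (Nat.coprime_primes Nat.prime_two hp).mpr (Ne.symm hp2)
      exact Nat.Coprime.pow_left 2 this
    exact_mod_cast this
  obtain ⟨c, hc⟩ := hcop.mul_dvd h4 hb
  rcases reduce_form p p b c (by exact_mod_cast hp.pos) le_rfl (by linear_combination hc) with h | h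
  · left; obtain ⟨v, hv⟩ := h 1 0; exact ⟨v, by rw [hv]; ring⟩
  · right; obtain ⟨v, hv⟩ := h 1 0; exact ⟨v, by rw [hv]; ring⟩

lemma qa_princ {p : ℕ} (hp : p.Prime) (hp2 : p ≠ 2) (hp23 : p ≠ 23) (h : ∃ v, qa v = p) :
    ∃ U V : ℤ, U ≠ 0 ∧ (p : ℤ) = U ^ 2 + 23 * V ^ 2 := by
  obtain ⟨⟨x, y⟩, h⟩ := h
  simp only [qa] at h
  have hodd : p % 2 = 1 := hp.eq_two_or_odd.resolve_left hp2
  have hy : y % 2 = 0 := by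
    by_contra hy
    obtain ⟨k, rfl⟩ : ∃ k, y = 2 * k + 1 := ⟨y / 2, by omega⟩
    have h1 : Even (x * (x + 1)) := Int.even_mul_succ_self x
    obtain ⟨r, hr⟩ := h1
    have : (p : ℤ) = 2 * (r + x * k + 3 * (2 * k + 1) ^ 2) := by rw [← h]; linear_combination hr
    omega
  obtain ⟨k, rfl⟩ : ∃ k, y = 2 * k := ⟨y / 2, by omega⟩
  have hpp : (p : ℤ) = (x + k) ^ 2 + 23 * k ^ 2 := by rw [← h]; ring
  refine ⟨x + k, k, ?_, hpp⟩
  intro h0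
  rw [h0] at hpp
  have : 23 ∣ p := by
    have : (23 : ℤ) ∣ p := ⟨k ^ 2, by rw [hpp]; ring⟩
    exact_mod_cast this
  exact hp23 ((Nat.prime_dvd_prime_iff_eq (by norm_num) hp).mp this).symm

lemma leg_two : legendreSym 23 2 = 1 := by
  rw [legendreSym.eq_one_iff]
  · exact ⟨5, by decide⟩
  · decide

lemma leg_recip {p : ℕ} [Fact p.Prime] (hp2 : p ≠ 2) (hp23 : p ≠ 23) :
    legendreSym p (-23) = legendreSym 23 p := by
  have h1 := legendreSym.quadratic_reciprocity (p := p) (q := 23) hp2 (by norm_num) hp23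
  have h2 : legendreSym p (-23) = legendreSym p (-1) * legendreSym p 23 := by
    rw [← legendreSym.mul]; norm_num
  have hodd : p % 2 = 1 := (Fact.out : p.Prime).eq_two_or_odd.resolve_left hp2
  rw [h2, legendreSym.at_neg_one hp2, ZMod.χ₄_eq_neg_one_pow hodd]
  have h3 : legendreSym p 23 * legendreSym p 23 = 1 := by
    rw [← sq]
    apply legendreSym.sq_one
    intro h
    have : ((23 : ℕ) : ZMod p) = 0 := by exact_mod_cast h
    rw [ZMod.natCast_eq_zero_iff] at this
    exact hp23 ((Nat.prime_dvd_prime_iff_eq Fact.out (by norm_num)).mp this)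
  have h5 : (-1 : ℤ) ^ (p / 2 * (23 / 2)) = (-1) ^ (p / 2) := by
    rw [mul_comm, pow_mul]; norm_num
  rw [h5] at h1
  push_cast at h1
  linear_combination (-(legendreSym p 23)) * h1 + (legendreSym 23 (p : ℤ)) * h3

lemma inert_ns {p : ℕ} (hp : p.Prime) (h : legendreSym 23 p = -1) :
    p ≠ 2 ∧ p ≠ 23 ∧ ∀ z : ZMod p, z ^ 2 ≠ -23 := by
  have : Fact p.Prime := ⟨hp⟩
  have hp2 : p ≠ 2 := by
    rintro rfl
    have := leg_two
    push_cast at h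
    omega
  have hp23 : p ≠ 23 := by
    rintro rfl
    have : legendreSym 23 ((23 : ℕ) : ℤ) = 0 := by
      rw [legendreSym.eq_zero_iff]; rfl
    omega
  refine ⟨hp2, hp23, fun z hz => ?_⟩
  rw [← leg_recip hp2 hp23, legendreSym.eq_neg_one_iff] at h
  apply h
  exact ⟨z, by push_cast; rw [← hz]; ring⟩

lemma split_s {p : ℕ} (hp : p.Prime) (hp2 : p ≠ 2) (hp23 : p ≠ 23) (h : legendreSym 23 p ≠ -1) :
    ∃ z : ZMod p, z ^ 2 = -23 := by
  have : Fact p.Prime := ⟨hp⟩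
  rw [← leg_recip hp2 hp23, Ne, legendreSym.eq_neg_one_iff, not_not] at h
  obtain ⟨z, hz⟩ := h
  exact ⟨z, by push_cast at hz; rw [hz]; ring⟩

lemma princ_leg {p : ℕ} (hp : p.Prime) {U V : ℤ} (hU : U ≠ 0)
    (h : (p : ℤ) = U ^ 2 + 23 * V ^ 2) : p ≠ 23 ∧ legendreSym 23 p ≠ -1 := by
  refine ⟨?_, ?_⟩
  · rintro rfl
    have h3 := (princ_facts hp hU h).2.2
    have h1 : V ≠ 0 := by rintro rfl; exact h3 (dvd_zero _)
    have : 0 < V ^ 2 := by positivity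
    have : 0 < U ^ 2 := by positivity
    push_cast at h
    omega
  · rw [Ne, legendreSym.eq_neg_one_iff, not_not, h]
    refine ⟨U, ?_⟩
    push_cast
    have : (23 : ZMod 23) = 0 := by decide
    rw [this]; ring

lemma nonpr_rep {p : ℕ} (hp : p.Prime) (hp23 : p ≠ 23) (h : legendreSym 23 p ≠ -1)
    (hn : ¬ ∃ U V : ℤ, U ≠ 0 ∧ (p : ℤ) = U ^ 2 + 23 * V ^ 2) :
    ∃ a b : ℤ, (p : ℤ) = qb (a, b) ∧ (p = 2 → a = 1 ∧ b = 0) := by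
  by_cases hp2 : p = 2
  · exact ⟨1, 0, by subst hp2; simp [qb], fun _ => ⟨rfl, rfl⟩⟩
  obtain ⟨z, hz⟩ := split_s hp hp2 hp23 h
  rcases split_rep hp hp2 z hz with h | ⟨⟨a, b⟩, h⟩
  · exact absurd (qa_princ hp hp2 hp23 h) hn
  · exact ⟨a, b, h.symm, fun h => absurd h hp2⟩

lemma prod_far {R : Type*} [CommRing R] (n : ℕ) (s : Finset ℕ) (hs : ∀ k ∈ s, n ≤ k) :
    (PowerSeries.X : PowerSeries R) ^ (n + 1) ∣
      (∏ k ∈ s, (1 - (PowerSeries.X : PowerSeries R) ^ (k + 1))) - 1 := by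
  classical
  induction s using Finset.induction_on with
  | empty => simp
  | insert a s ha ih =>
    rw [Finset.prod_insert ha]
    have h1 := ih (fun k hk => hs k (Finset.mem_insert_of_mem hk))
    have h2 : (PowerSeries.X : PowerSeries R) ^ (n + 1) ∣ PowerSeries.X ^ (a + 1) :=
      pow_dvd_pow _ (by have := hs a (Finset.mem_insert_self a s); omega)
    have h3 : (1 - (PowerSeries.X : PowerSeries R) ^ (a + 1)) *
        (∏ k ∈ s, (1 - (PowerSeries.X : PowerSeries R) ^ (k + 1))) - 1 =
        ((∏ k ∈ s, (1 - (PowerSeries.X : PowerSeries R) ^ (k + 1))) - 1) -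
        PowerSeries.X ^ (a + 1) * (∏ k ∈ s, (1 - (PowerSeries.X : PowerSeries R) ^ (k + 1))) := by
      ring
    rw [h3]
    exact dvd_sub h1 (h2.mul_right _)

noncomputable def pent (i : ℕ) : ZMod 23 := PowerSeries.coeff i (PowerSeries.pentagonalSeries (ZMod 23))

noncomputable def Qp (n : ℕ) : Polynomial (ZMod 23) :=
  ∏ k ∈ Finset.Icc 1 n, ((1 : Polynomial (ZMod 23)) - Polynomial.X ^ k)

lemma Qp_coeff (n i : ℕ) (hi : i ≤ n) : (Qp n).coeff i = pent i := by
  classical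
  have h := PowerSeries.coeff_prod_one_sub_X_pow_eventually_eq (ZMod 23) i
  obtain ⟨s, hs⟩ := Filter.eventually_atTop.mp h
  have h1 := hs (s ∪ Finset.range n) Finset.subset_union_left
  unfold pent
  rw [← h1, ← Polynomial.coeff_coe]
  have h2 : ((Qp n : Polynomial (ZMod 23)) : PowerSeries (ZMod 23)) =
      ∏ k ∈ Finset.range n, (1 - (PowerSeries.X : PowerSeries (ZMod 23)) ^ (k + 1)) := by
    clear h1 hs h hi
    induction n with
    | zero => simp [Qp]
    | succ m ih =>
      have e : Qp (m + 1) = Qp m * (1 - Polynomial.X ^ (m + 1)) := by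
        unfold Qp
        rw [Finset.prod_Icc_succ_top (by omega)]
      rw [e, Finset.prod_range_succ, ← ih]
      simp
  rw [h2, ← Finset.prod_sdiff (Finset.subset_union_right : Finset.range n ⊆ s ∪ Finset.range n)]
  have h3 := prod_far (R := ZMod 23) n ((s ∪ Finset.range n) \ Finset.range n) (by
    intro k hk; simp at hk; omega)
  have h4 := (PowerSeries.X_pow_dvd_iff.mp (h3.mul_right
    (∏ k ∈ Finset.range n, (1 - (PowerSeries.X : PowerSeries (ZMod 23)) ^ (k + 1))))) i (by omega)
  rw [sub_mul, one_mul, map_sub, sub_eq_zero] at h4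
  exact h4.symm

lemma tau_cast (n : ℕ) : (ramanujanTau (n + 1) : ZMod 23) =
    ∑ x ∈ Finset.HasAntidiagonal.antidiagonal n, pent x.1 * (if 23 ∣ x.2 then pent (x.2 / 23) else 0) := by
  unfold ramanujanTau
  rw [Polynomial.coeff_X_mul]
  have h1 : ((((∏ k ∈ Finset.Icc 1 (n + 1), ((1 : Polynomial ℤ) - Polynomial.X ^ k) ^ 24).coeff n : ℤ)) : ZMod 23)
      = (Qp (n + 1) ^ 24).coeff n := by
    have hm : Polynomial.map (Int.castRingHom (ZMod 23))
        (∏ k ∈ Finset.Icc 1 (n + 1), ((1 : Polynomial ℤ) - Polynomial.X ^ k) ^ 24) =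
        Qp (n + 1) ^ 24 := by
      rw [Polynomial.map_prod]
      unfold Qp
      rw [← Finset.prod_pow]
      apply Finset.prod_congr rfl
      intro k _
      rw [Polynomial.map_pow, Polynomial.map_sub, Polynomial.map_pow, Polynomial.map_one,
        Polynomial.map_X]
    rw [← hm, Polynomial.coeff_map]
    rfl
  rw [h1, pow_succ', ← ZMod.expand_card, Polynomial.coeff_mul]
  apply Finset.sum_congr rfl
  intro x hx
  rw [Finset.HasAntidiagonal.mem_antidiagonal] at hx
  rw [Polynomial.coeff_expand (by norm_num), Qp_coeff _ _ (by omega)]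
  split_ifs with h
  · rw [Qp_coeff _ _ (by omega)]
  · rfl

def chi (x : ℤ) : ℤ :=
  if x % 12 = 1 ∨ x % 12 = 11 then 1 else if x % 12 = 5 ∨ x % 12 = 7 then -1 else 0

lemma chi_six (k : ℤ) : chi (6 * k - 1) = ((Int.negOnePow k : ℤˣ) : ℤ) := by
  rcases Int.even_or_odd k with h | h
  · rw [Int.negOnePow_even k h]
    obtain ⟨m, rfl⟩ := h
    have : (6 * (m + m) - 1) % 12 = 11 := by omega
    simp [chi, this]
  · rw [Int.negOnePow_odd k h]
    obtain ⟨m, rfl⟩ := h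
    have : (6 * (2 * m + 1) - 1) % 12 = 5 := by omega
    simp [chi, this]

lemma chi_neg (x : ℤ) : chi (-x) = chi x := by
  unfold chi
  split_ifs <;> omega

lemma pent_sum (i : ℕ) (B : ℤ) (hB : 24 * i + 1 ≤ B) :
    2 * pent i = ((∑ x ∈ Finset.Icc (-B) B, if x ^ 2 = 24 * i + 1 then chi x else 0 : ℤ) : ZMod 23) := by
  classical
  by_cases h : i ∈ Set.range pentagonal
  · obtain ⟨k, rfl⟩ := h
    have hk := two_mul_natCast_pentagonal k
    have e : (24 * (pentagonal k : ℤ) + 1) = (6 * k - 1) ^ 2 := by linear_combination 12 * hk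
    have hne : (6 * k - 1) ≠ -(6 * k - 1) := by omega
    rw [← Finset.sum_filter]
    have hS : (Finset.Icc (-B) B).filter (fun x => x ^ 2 = 24 * (pentagonal k : ℤ) + 1) =
        {6 * k - 1, -(6 * k - 1)} := by
      ext x
      simp only [Finset.mem_filter, Finset.mem_Icc, Finset.mem_insert, Finset.mem_singleton]
      rw [e, sq_eq_sq_iff_eq_or_eq_neg]
      constructor
      · exact fun h => h.2
      · intro h
        refine ⟨?_, h⟩
        rw [e] at hB
        constructor <;> rcases h with rfl | rfl <;> nlinarith
    rw [hS, Finset.sum_pair hne, chi_neg, chi_six, pent, PowerSeries.coeff_pentagonalSeries_pentagonal]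
    push_cast
    ring
  · rw [pent, PowerSeries.coeff_pentagonalSeries_eq_zero _ h, mul_zero]
    symm
    rw [Finset.sum_eq_zero]
    · simp
    · intro x _
      rw [if_neg]
      intro hx
      apply h
      have hm : x % 6 = 1 ∨ x % 6 = 5 := by
        have : x ^ 2 % 6 = 1 := by omega
        have h6 : x % 6 = 0 ∨ x % 6 = 1 ∨ x % 6 = 2 ∨ x % 6 = 3 ∨ x % 6 = 4 ∨ x % 6 = 5 := by omega
        rcases h6 with h | h | h | h | h | h <;> simp [pow_two, Int.mul_emod, h] at this ⊢
      have key : ∃ k : ℤ, x ^ 2 = (6 * k - 1) ^ 2 := by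
        rcases hm with h | h
        · exact ⟨-(x / 6), by
            have : x = 6 * (x / 6) + 1 := by omega
            conv_lhs => rw [this]
            ring⟩
        · exact ⟨x / 6 + 1, by
            have : x = 6 * (x / 6) + 5 := by omega
            conv_lhs => rw [this]
            ring⟩
      obtain ⟨k, hk⟩ := key
      refine ⟨k, ?_⟩
      have h2 := two_mul_natCast_pentagonal k
      have : (24 : ℤ) * (pentagonal k : ℤ) = 24 * i := by linear_combination 12 * h2 - hk + hx
      omega

noncomputable def Esum (m : ℤ) : ℤ := ∑ x ∈ Finset.Icc (-(24 * m)) (24 * m), ∑ y ∈ Finset.Icc (-(24 * m)) (24 * m),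
  if x ^ 2 + 23 * y ^ 2 = 24 * m then chi x * chi y else 0

lemma chi_sq {x : ℤ} (h : chi x ≠ 0) : ∃ k : ℕ, x ^ 2 = 24 * k + 1 := by
  have hm : x % 12 = 1 ∨ x % 12 = 11 ∨ x % 12 = 5 ∨ x % 12 = 7 := by
    unfold chi at h
    split_ifs at h <;> omega
  have h24 : x ^ 2 % 24 = 1 := by
    have h6 : x % 24 = 1 ∨ x % 24 = 11 ∨ x % 24 = 5 ∨ x % 24 = 7 ∨ x % 24 = 13 ∨ x % 24 = 23 ∨ x % 24 = 17 ∨ x % 24 = 19 := by omega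
    rcases h6 with h | h | h | h | h | h | h | h <;> simp [pow_two, Int.mul_emod, h]
  have := sq_nonneg x
  exact ⟨((x ^ 2 - 1) / 24).toNat, by omega⟩

lemma ant_sum (n : ℕ) (x y : ℤ) :
    (∑ a ∈ Finset.HasAntidiagonal.antidiagonal n,
      if x ^ 2 = 24 * (a.1 : ℤ) + 1 ∧ 23 ∣ a.2 ∧ y ^ 2 = 24 * ((a.2 / 23 : ℕ) : ℤ) + 1
        then chi x * chi y else 0) =
      if x ^ 2 + 23 * y ^ 2 = 24 * ((n : ℤ) + 1) then chi x * chi y else 0 := by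
  by_cases h0 : chi x * chi y = 0
  · simp [h0]
  have hx : chi x ≠ 0 := fun h => h0 (by simp [h])
  have hy : chi y ≠ 0 := fun h => h0 (by simp [h])
  obtain ⟨i, hi⟩ := chi_sq hx
  obtain ⟨j, hj⟩ := chi_sq hy
  rw [hi, hj]
  split_ifs with h
  · rw [Finset.sum_eq_single (i, 23 * j)]
    · simp
    · rintro ⟨a, b⟩ hab hne
      rw [Finset.HasAntidiagonal.mem_antidiagonal] at hab
      rw [if_neg]
      rintro ⟨h1, h2, h3⟩
      apply hne
      simp only at h1 h2 h3 hab
      have : a = i := by omega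
      have : b = 23 * j := by omega
      simp [*]
    · intro hab
      exfalso; apply hab
      rw [Finset.HasAntidiagonal.mem_antidiagonal]
      simp only
      omega
  · apply Finset.sum_eq_zero
    rintro ⟨a, b⟩ hab
    rw [Finset.HasAntidiagonal.mem_antidiagonal] at hab
    rw [if_neg]
    rintro ⟨h1, h2, h3⟩
    simp only at h1 h2 h3 hab
    omega

lemma four_tau (n : ℕ) : 4 * (ramanujanTau (n + 1) : ZMod 23) = ((Esum ((n : ℤ) + 1) : ℤ) : ZMod 23) := by
  have h1 : Esum ((n : ℤ) + 1) = ∑ a ∈ Finset.HasAntidiagonal.antidiagonal n,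
      (∑ x ∈ Finset.Icc (-(24 * ((n : ℤ) + 1))) (24 * ((n : ℤ) + 1)), if x ^ 2 = 24 * (a.1 : ℤ) + 1 then chi x else 0) *
      (if 23 ∣ a.2 then (∑ x ∈ Finset.Icc (-(24 * ((n : ℤ) + 1))) (24 * ((n : ℤ) + 1)), if x ^ 2 = 24 * ((a.2 / 23 : ℕ) : ℤ) + 1 then chi x else 0) else 0) := by
    unfold Esum
    simp_rw [← ant_sum]
    have : ∀ x ∈ Finset.Icc (-(24 * ((n : ℤ) + 1))) (24 * ((n : ℤ) + 1)),
      (∑ y ∈ Finset.Icc (-(24 * ((n : ℤ) + 1))) (24 * ((n : ℤ) + 1)),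
        ∑ a ∈ Finset.HasAntidiagonal.antidiagonal n,
      if x ^ 2 = 24 * (a.1 : ℤ) + 1 ∧ 23 ∣ a.2 ∧ y ^ 2 = 24 * ((a.2 / 23 : ℕ) : ℤ) + 1
        then chi x * chi y else 0) = ∑ a ∈ Finset.HasAntidiagonal.antidiagonal n, 
        ∑ y ∈ Finset.Icc (-(24 * ((n : ℤ) + 1))) (24 * ((n : ℤ) + 1)),
      if x ^ 2 = 24 * (a.1 : ℤ) + 1 ∧ 23 ∣ a.2 ∧ y ^ 2 = 24 * ((a.2 / 23 : ℕ) : ℤ) + 1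
        then chi x * chi y else 0 := fun x _ => Finset.sum_comm
    rw [Finset.sum_congr rfl this, Finset.sum_comm]
    apply Finset.sum_congr rfl
    intro a _
    by_cases h : 23 ∣ a.2
    · rw [if_pos h, Finset.sum_mul_sum]
      apply Finset.sum_congr rfl
      intro x _
      apply Finset.sum_congr rfl
      intro y _
      by_cases hx : x ^ 2 = 24 * (a.1 : ℤ) + 1 <;>
      by_cases hy : y ^ 2 = 24 * ((a.2 / 23 : ℕ) : ℤ) + 1 <;> simp only [hx, hy, h, true_and, false_and, and_true, and_false, if_true, if_false, mul_zero, zero_mul]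
    · simp [h]
  rw [h1, tau_cast, Int.cast_sum, Finset.mul_sum]
  apply Finset.sum_congr rfl
  intro a ha
  rw [Finset.HasAntidiagonal.mem_antidiagonal] at ha
  rw [Int.cast_mul, ← pent_sum _ _ (by omega)]
  split_ifs with h
  · rw [← pent_sum _ _ (by omega)]; ring
  · simp

lemma chi_prod (x y : ℤ) (h : (x ^ 2 - y ^ 2) % 12 = 0) : chi x * chi y =
    (if 4 ∣ x - y ∧ 3 ∣ x - y then 1 else 0) + (if 4 ∣ x + y ∧ 3 ∣ x + y then 1 else 0)
    - (if 4 ∣ x + y ∧ 3 ∣ x - y then 1 else 0) - (if 4 ∣ x - y ∧ 3 ∣ x + y then 1 else 0) := by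
  have key : ∀ r q : Fin 12, (((r : ℕ) : ℤ) ^ 2 - ((q : ℕ) : ℤ) ^ 2) % 12 = 0 → 
     chi ((r : ℕ) : ℤ) * chi ((q : ℕ) : ℤ) =
    (if (((r : ℕ) : ℤ) - ((q : ℕ) : ℤ)) % 4 = 0 ∧ (((r : ℕ) : ℤ) - ((q : ℕ) : ℤ)) % 3 = 0 then 1 else 0) + 
    (if (((r : ℕ) : ℤ) + ((q : ℕ) : ℤ)) % 4 = 0 ∧ (((r : ℕ) : ℤ) + ((q : ℕ) : ℤ)) % 3 = 0 then 1 else 0)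
    - (if (((r : ℕ) : ℤ) + ((q : ℕ) : ℤ)) % 4 = 0 ∧ (((r : ℕ) : ℤ) - ((q : ℕ) : ℤ)) % 3 = 0 then 1 else 0) -
     (if (((r : ℕ) : ℤ) - ((q : ℕ) : ℤ)) % 4 = 0 ∧ (((r : ℕ) : ℤ) + ((q : ℕ) : ℤ)) % 3 = 0 then 1 else 0) := by
    decide
  obtain ⟨r, hr⟩ : ∃ r : Fin 12, ((r : ℕ) : ℤ) = x % 12 := ⟨⟨(x % 12).toNat, by omega⟩, by simp only; omega⟩
  obtain ⟨q, hq⟩ : ∃ r : Fin 12, ((r : ℕ) : ℤ) = y % 12 := ⟨⟨(y % 12).toNat, by omega⟩, by simp only; omega⟩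
  have hk := key r q (by rw [hr, hq, ← h]; simp [Int.sub_emod, pow_two, Int.mul_emod])
  rw [hr, hq] at hk
  have c1 : ∀ z : ℤ, chi (z % 12) = chi z := fun z => by unfold chi; rw [Int.emod_emod_of_dvd z (dvd_refl 12)]
  rw [c1, c1] at hk
  rw [hk]
  have e1 : 4 ∣ x - y ↔ (x % 12 - y % 12) % 4 = 0 := by omega
  have e2 : 3 ∣ x - y ↔ (x % 12 - y % 12) % 3 = 0 := by omega
  have e3 : 4 ∣ x + y ↔ (x % 12 + y % 12) % 4 = 0 := by omega
  have e4 : 3 ∣ x + y ↔ (x % 12 + y % 12) % 3 = 0 := by omega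
  simp only [e1, e2, e3, e4]

lemma Esum_eq (m : ℤ) : Esum m = 2 * (rn qa m - rn qb m) := by
  classical
  set D : Finset (ℤ × ℤ) := ((Finset.Icc (-(24 * m)) (24 * m)) ×ˢ (Finset.Icc (-(24 * m)) (24 * m))).filter
    (fun v => v.1 ^ 2 + 23 * v.2 ^ 2 = 24 * m) with hD
  have memD : ∀ v : ℤ × ℤ, v ∈ D ↔ v.1 ^ 2 + 23 * v.2 ^ 2 = 24 * m := by
    intro v
    rw [hD, Finset.mem_filter, Finset.mem_product, Finset.mem_Icc, Finset.mem_Icc]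
    constructor
    · exact fun h => h.2
    · intro h
      refine ⟨⟨⟨?_, ?_⟩, ⟨?_, ?_⟩⟩, h⟩ <;> nlinarith [sq_nonneg v.1, sq_nonneg v.2, sq_nonneg (v.1 - 1), sq_nonneg (v.1 + 1), sq_nonneg (v.2 + 1), sq_nonneg (v.2 - 1), Int.le_self_sq v.1, Int.le_self_sq v.2, Int.le_self_sq (-v.1), Int.le_self_sq (-v.2)]
  have h1 : Esum m = ∑ v ∈ D, chi v.1 * chi v.2 := by
    rw [hD, Finset.sum_filter, Finset.sum_product]
    rfl
  have h2 : ∀ v ∈ D, chi v.1 * chi v.2 = 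
    (if 4 ∣ v.1 - v.2 ∧ 3 ∣ v.1 - v.2 then 1 else 0) + (if 4 ∣ v.1 + v.2 ∧ 3 ∣ v.1 + v.2 then 1 else 0)
    - (if 4 ∣ v.1 + v.2 ∧ 3 ∣ v.1 - v.2 then 1 else 0) - (if 4 ∣ v.1 - v.2 ∧ 3 ∣ v.1 + v.2 then 1 else 0) := by
    intro v hv
    apply chi_prod
    rw [memD] at hv
    omega
  have ca : ((D.filter (fun v => 4 ∣ v.1 - v.2 ∧ 3 ∣ v.1 - v.2)).card : ℤ) = rn qa m := by
    rw [← Set.ncard_coe_finset, rn]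
    congr 1
    symm
    refine Set.ncard_congr (fun v _ => (v.1 - 11 * v.2, v.1 + v.2)) ?_ ?_ ?_
    · intro v hv
      have hv' : qa v = m := hv
      simp only [qa] at hv'
      simp only [Finset.coe_filter, Set.mem_ofPred_eq, memD]
      refine ⟨by rw [← hv']; ring, ?_, ?_⟩ <;> omega
    · rintro ⟨a, b⟩ ⟨c, d⟩ _ _ h
      simp only [Prod.mk.injEq] at h ⊢
      omega
    · rintro ⟨x, y⟩ hv
      simp only [Finset.coe_filter, Set.mem_ofPred_eq, memD] at hv
      obtain ⟨hv, h4, h3⟩ := hv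
      obtain ⟨t, ht⟩ : (12 : ℤ) ∣ y - x := by omega
      refine ⟨(y - t, t), ?_, by simp only [Prod.mk.injEq]; omega⟩
      have hx : x = y - 12 * t := by omega
      subst hx
      simp only [Set.mem_ofPred_eq, qa]
      apply mul_left_cancel₀ (by norm_num : (24 : ℤ) ≠ 0)
      rw [← hv]; ring
  have cb : ((D.filter (fun v => 4 ∣ v.1 + v.2 ∧ 3 ∣ v.1 - v.2)).card : ℤ) = rn qb m := by
    rw [← Set.ncard_coe_finset, rn]
    congr 1
    symm
    refine Set.ncard_congr (fun v _ => (5 * v.1 + 7 * v.2, v.2 - v.1)) ?_ ?_ ?_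
    · intro v hv
      have hv' : qb v = m := hv
      simp only [qb] at hv'
      simp only [Finset.coe_filter, Set.mem_ofPred_eq, memD]
      refine ⟨by rw [← hv']; ring, ?_, ?_⟩ <;> omega
    · rintro ⟨a, b⟩ ⟨c, d⟩ _ _ h
      simp only [Prod.mk.injEq] at h ⊢
      omega
    · rintro ⟨x, y⟩ hv
      simp only [Finset.coe_filter, Set.mem_ofPred_eq, memD] at hv
      obtain ⟨hv, h4, h3⟩ := hv
      obtain ⟨t, ht⟩ : (12 : ℤ) ∣ x + 5 * y := by omega
      refine ⟨(t - y, t), ?_, by simp only [Prod.mk.injEq]; omega⟩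
      have hx : x = 12 * t - 5 * y := by omega
      subst hx
      simp only [Set.mem_ofPred_eq, qb]
      apply mul_left_cancel₀ (by norm_num : (24 : ℤ) ≠ 0)
      rw [← hv]; ring
  have sa : (D.filter (fun v => 4 ∣ v.1 + v.2 ∧ 3 ∣ v.1 + v.2)).card = (D.filter (fun v => 4 ∣ v.1 - v.2 ∧ 3 ∣ v.1 - v.2)).card := by
    apply Finset.card_nbij' (fun v => (v.1, -v.2)) (fun v => (v.1, -v.2)) <;> intro v hv <;> simp [memD, sub_neg_eq_add, ← sub_eq_add_neg] at hv ⊢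
    · exact hv
    · exact hv
  have sb : (D.filter (fun v => 4 ∣ v.1 - v.2 ∧ 3 ∣ v.1 + v.2)).card = (D.filter (fun v => 4 ∣ v.1 + v.2 ∧ 3 ∣ v.1 - v.2)).card := by
    apply Finset.card_nbij' (fun v => (v.1, -v.2)) (fun v => (v.1, -v.2)) <;> intro v hv <;> simp [memD, sub_neg_eq_add, ← sub_eq_add_neg] at hv ⊢
    · exact hv
    · exact hv
  rw [h1, Finset.sum_congr rfl h2, Finset.sum_sub_distrib, Finset.sum_sub_distrib, Finset.sum_add_distrib]
  rw [Finset.sum_boole, Finset.sum_boole, Finset.sum_boole, Finset.sum_boole, sa, sb]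
  rw [ca, cb]
  ring

lemma tau_iff (n : ℕ) (hn : n ≠ 0) : (23 : ℤ) ∣ ramanujanTau n ↔ ((rn qa n - rn qb n : ℤ) : ZMod 23) = 0 := by
  obtain ⟨m, rfl⟩ := Nat.exists_eq_succ_of_ne_zero hn
  have h := four_tau m
  rw [Esum_eq] at h
  have h23 : (23 : ℤ) ∣ ramanujanTau (m + 1) ↔ ((ramanujanTau (m + 1) : ℤ) : ZMod 23) = 0 :=
    (ZMod.intCast_zmod_eq_zero_iff_dvd _ 23).symm
  rw [Nat.succ_eq_add_one, h23]
  push_cast at h ⊢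
  have e4 : (4 : ZMod 23) ≠ 0 := by decide
  have e2 : (2 : ZMod 23) ≠ 0 := by decide
  constructor
  · intro h0
    rw [h0, mul_zero] at h
    rcases mul_eq_zero.mp h.symm with h | h
    · exact absurd h e2
    · exact h
  · intro h0
    rw [h0, mul_zero] at h
    rcases mul_eq_zero.mp h with h | h
    · exact absurd h e4
    · exact h

noncomputable def cc (n : ℤ) : ZMod 23 := 12 * ((rn qa n - rn qb n : ℤ) : ZMod 23)

noncomputable def scc (p : ℕ) (n : ℤ) : ZMod 23 :=
  12 * ((rn (fun v => (p : ℤ) * qa v) n - rn (fun v => (p : ℤ) * qb v) n : ℤ) : ZMod 23)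

def Hk (p : ℕ) (l e : ZMod 23) : Prop := ∀ n : ℤ, cc (p * n) = l * cc n - e * scc p n

lemma rn_scale (q : ℤ × ℤ → ℤ) {p : ℕ} (hp : p.Prime) (n : ℤ) :
    rn (fun v => (p : ℤ) * q v) (p * n) = rn q n := by
  unfold rn
  congr 2
  ext v
  simp [hp.ne_zero]

lemma rn_scale_zero (q : ℤ × ℤ → ℤ) {p : ℕ} (n : ℤ) (h : ¬ (p : ℤ) ∣ n) :
    rn (fun v => (p : ℤ) * q v) n = 0 := by
  unfold rn
  have : {v | (fun v => (p : ℤ) * q v) v = n} = (∅ : Set (ℤ × ℤ)) := by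
    ext v
    simp only [Set.mem_ofPred_eq, Set.mem_empty_iff_false, iff_false]
    intro hv
    exact h ⟨q v, hv.symm⟩
  rw [this]; simp

lemma cc_one : cc 1 = 1 := by
  have h1 : rn qa 1 = 2 := by
    have : {v | qa v = 1} = ({(1, 0), (-1, 0)} : Set (ℤ × ℤ)) := by
      ext ⟨x, y⟩
      simp only [Set.mem_ofPred_eq, Set.mem_insert_iff, Set.mem_singleton_iff, Prod.mk.injEq, qa]
      constructor
      · intro h
        have hy : y = 0 := by
          have h1 : (2 * x + y) ^ 2 + 23 * y ^ 2 = 4 := by linear_combination 4 * h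
          have h2 : y < 1 := by nlinarith [sq_nonneg (2 * x + y)]
          have h3 : -1 < y := by nlinarith [sq_nonneg (2 * x + y)]
          omega
        subst hy
        have : (x - 1) * (x + 1) = 0 := by linear_combination h
        rcases mul_eq_zero.mp this with h | h <;> omega
      · rintro (⟨rfl, rfl⟩ | ⟨rfl, rfl⟩) <;> norm_num
    rw [rn, this, Set.ncard_pair (by simp)]
    rfl
  have h2 : rn qb 1 = 0 := by
    have : {v | qb v = 1} = (∅ : Set (ℤ × ℤ)) := by
      ext ⟨x, y⟩
      simp only [Set.mem_ofPred_eq, Set.mem_empty_iff_false, iff_false, qb]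
      intro h
      have h1 : (4 * x + y) ^ 2 + 23 * y ^ 2 = 8 := by linear_combination 8 * h
      have hy : y = 0 := by
          have h2 : y < 1 := by nlinarith [sq_nonneg (4 * x + y)]
          have h3 : -1 < y := by nlinarith [sq_nonneg (4 * x + y)]
          omega
      subst hy
      have : 2 * (x * x) = 1 := by linear_combination h
      omega
    rw [rn, this]; simp
  rw [cc, h1, h2]; decide

lemma Hk_princ {p : ℕ} (hp : p.Prime) {U V : ℤ} (hU : U ≠ 0) (h : (p : ℤ) = U ^ 2 + 23 * V ^ 2) :
    Hk p 2 1 := by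
  intro n
  have ha := princ_a hp hU h n
  have hb := princ_b hp hU h n
  unfold cc scc
  have ha' := congrArg (Int.cast : ℤ → ZMod 23) ha
  have hb' := congrArg (Int.cast : ℤ → ZMod 23) hb
  push_cast at ha' hb' ⊢
  linear_combination 12 * ha' - 12 * hb'

lemma Hk_nonpr {p : ℕ} (hp : p.Prime) (hp23 : p ≠ 23) {a b : ℤ} (h : (p : ℤ) = qb (a, b))
    (hp2 : p = 2 → a = 1 ∧ b = 0) : Hk p (-1) 1 := by
  intro n
  have ha := nonpr_a hp hp23 h hp2 n
  have hb := nonpr_b hp hp23 h hp2 n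
  unfold cc scc
  have ha' := congrArg (Int.cast : ℤ → ZMod 23) ha
  have hb' := congrArg (Int.cast : ℤ → ZMod 23) hb
  push_cast at ha' hb' ⊢
  linear_combination 12 * ha' - 12 * hb'

lemma Hk_inert {p : ℕ} (hp : p.Prime) (hp2 : p ≠ 2) (hns : ∀ z : ZMod p, z ^ 2 ≠ -23) :
    Hk p 0 (-1) := by
  intro n
  have ha := inert_a hp hp2 hns n
  have hb := inert_b hp hp2 hns n
  unfold cc scc
  rw [ha, hb]
  ring

lemma Hk_ram : Hk 23 1 0 := by
  intro n
  have ha := ram_a n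
  have hb := ram_b n
  unfold cc
  push_cast
  rw [ha, hb]
  ring

def ww (l e : ZMod 23) : ℕ → ZMod 23
  | 0 => 1
  | 1 => l
  | (k + 2) => l * ww l e (k + 1) - e * ww l e k

lemma cc_pow {p : ℕ} (hp : p.Prime) {l e : ZMod 23} (H : Hk p l e) (m : ℤ) (hm : ¬ (p : ℤ) ∣ m) :
    ∀ k : ℕ, cc ((p : ℤ) ^ k * m) = ww l e k * cc m ∧ cc ((p : ℤ) ^ (k + 1) * m) = ww l e (k + 1) * cc m := by
  intro k
  induction k with
  | zero =>
    refine ⟨by simp [ww], ?_⟩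
    have h0 : scc p m = 0 := by
      unfold scc
      rw [rn_scale_zero _ _ hm, rn_scale_zero _ _ hm]; simp
    rw [zero_add, pow_one, H m, h0]
    simp [ww]
  | succ k ih =>
    refine ⟨ih.2, ?_⟩
    have h0 : scc p ((p : ℤ) ^ (k + 1) * m) = cc ((p : ℤ) ^ k * m) := by
      unfold scc cc
      rw [pow_succ', mul_assoc, rn_scale _ hp, rn_scale _ hp]
    have e1 : (p : ℤ) ^ (k + 1 + 1) * m = p * (p ^ (k + 1) * m) := by ring
    rw [e1, H, h0, ih.1, ih.2, ww]
    ring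

lemma cc_pow_one {p : ℕ} (hp : p.Prime) {l e : ZMod 23} (H : Hk p l e) (k : ℕ) :
    cc ((p ^ k : ℕ) : ℤ) = ww l e k := by
  have h := (cc_pow hp H 1 (by
    intro h
    have : p ∣ 1 := by exact_mod_cast h
    exact hp.one_lt.ne' (Nat.dvd_one.mp this)) k).1
  rw [mul_one, cc_one, mul_one] at h
  push_cast
  exact h

lemma Hk_exists {p : ℕ} (hp : p.Prime) : ∃ l e, Hk p l e := by
  by_cases h23 : p = 23
  · subst h23; exact ⟨_, _, Hk_ram⟩
  by_cases hl : legendreSym 23 p = -1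
  · obtain ⟨h1, _, h3⟩ := inert_ns hp hl
    exact ⟨_, _, Hk_inert hp h1 h3⟩
  by_cases hpr : ∃ U V : ℤ, U ≠ 0 ∧ (p : ℤ) = U ^ 2 + 23 * V ^ 2
  · obtain ⟨U, V, hU, h⟩ := hpr
    exact ⟨_, _, Hk_princ hp hU h⟩
  · obtain ⟨a, b, h, h2⟩ := nonpr_rep hp h23 hl hpr
    exact ⟨_, _, Hk_nonpr hp h23 h h2⟩

lemma cc_mul (a : ℕ) : ∀ b : ℕ, Nat.Coprime a b → cc ((a * b : ℕ) : ℤ) = cc a * cc b := by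
  induction a using Nat.recOnPrimeCoprime with
  | zero =>
    intro b hb
    have : b = 1 := by simpa using hb
    subst this
    simp [cc_one]
  | prime_pow p n hp =>
    intro b hb
    obtain ⟨l, e, H⟩ := Hk_exists hp
    rcases Nat.eq_zero_or_pos n with rfl | hn
    · simp [cc_one]
    · have hpb : ¬ (p : ℤ) ∣ b := by
        intro h
        have h' : p ∣ b := by exact_mod_cast h
        have := Nat.Coprime.coprime_dvd_left (dvd_pow_self p hn.ne') hb
        exact (Nat.Prime.coprime_iff_not_dvd hp).mp this h'
      rw [cc_pow_one hp H]
      have := (cc_pow hp H b hpb n).1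
      push_cast
      exact this
  | coprime a b ha hb hab iha ihb =>
    intro c hc
    have h1 : Nat.Coprime a c := hc.coprime_mul_right
    have h2 : Nat.Coprime b c := hc.coprime_mul_left
    rw [mul_assoc, iha _ (Nat.Coprime.mul_right hab h1), ihb _ h2, iha _ hab, mul_assoc]

lemma t23_eq (n : ℕ) (hn : n ≠ 0) : t23 n = if cc n = 0 then 0 else 1 := by
  have h12 : (12 : ZMod 23) ≠ 0 := by decide
  have key : (23 : ℤ) ∣ ramanujanTau n ↔ cc n = 0 := by
    rw [tau_iff n hn, cc]
    simp [h12]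
  unfold t23
  by_cases h : cc n = 0
  · rw [if_pos (key.mpr h), if_pos h]
  · rw [if_neg (fun h' => h (key.mp h')), if_neg h]

lemma t23_zero : t23 0 = 0 := by
  simp [t23, ramanujanTau]

lemma t23_one : t23 1 = 1 := by
  have h : cc ((1 : ℕ) : ℤ) ≠ 0 := by rw [Nat.cast_one, cc_one]; decide
  rw [t23_eq 1 (by norm_num), if_neg h]

lemma t23_mul {a b : ℕ} (h : Nat.Coprime a b) : t23 (a * b) = t23 a * t23 b := by
  rcases Nat.eq_zero_or_pos a with rfl | ha
  · simp [t23_zero]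
  rcases Nat.eq_zero_or_pos b with rfl | hb
  · simp [t23_zero]
  rw [t23_eq _ (by positivity), t23_eq a (by omega), t23_eq b (by omega), cc_mul a b h]
  by_cases h1 : cc a = 0 <;> by_cases h2 : cc b = 0 <;> simp [h1, h2]

lemma t23_bound (n : ℕ) : 0 ≤ t23 n ∧ t23 n ≤ 1 := by
  unfold t23; split_ifs <;> norm_num

lemma t23_pow {p : ℕ} (hp : p.Prime) {l e : ZMod 23} (H : Hk p l e) (k : ℕ) :
    t23 (p ^ k) = if ww l e k = 0 then 0 else 1 := by
  rw [t23_eq _ (pow_ne_zero _ hp.ne_zero), cc_pow_one hp H]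

lemma ww_ram (k : ℕ) : ww 1 0 k = 1 := by
  induction k using Nat.twoStepInduction with
  | zero => rfl
  | one => rfl
  | more k h1 h2 => rw [ww, h2]; ring

lemma ww_inert (k : ℕ) : ww 0 (-1) (2 * k) = 1 ∧ ww 0 (-1) (2 * k + 1) = 0 := by
  induction k with
  | zero => exact ⟨rfl, rfl⟩
  | succ k ih =>
    have e1 : 2 * (k + 1) = 2 * k + 2 := by ring
    rw [e1, show 2 * k + 2 + 1 = (2 * k + 1) + 2 by ring, ww, ww, ih.1, ih.2]
    constructor <;> ring

lemma ww_nonpr (k : ℕ) : ww (-1) 1 (3 * k) = 1 ∧ ww (-1) 1 (3 * k + 1) = -1 ∧ ww (-1) 1 (3 * k + 2) = 0 := by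
  induction k with
  | zero => exact ⟨rfl, rfl, by decide⟩
  | succ k ih =>
    have h3 : ww (-1) 1 (3 * (k + 1)) = 1 := by
      rw [show 3 * (k + 1) = (3 * k + 1) + 2 by ring, ww, ih.2.1, ih.2.2]; ring
    have h4 : ww (-1) 1 (3 * (k + 1) + 1) = -1 := by
      rw [show 3 * (k + 1) + 1 = (3 * k + 2) + 2 by ring, ww, ih.2.2,
        show 3 * k + 2 + 1 = 3 * (k + 1) by ring, h3]; ring
    exact ⟨h3, h4, by rw [ww, h3, h4]; ring⟩

lemma ww_princ (k : ℕ) : ww 2 1 k = k + 1 := by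
  induction k using Nat.twoStepInduction with
  | zero => simp [ww]
  | one => simp only [ww]; push_cast; ring
  | more k h1 h2 => rw [ww, h2, h1]; push_cast; ring

lemma summ_aux (a : ℕ → ℝ) (ha : ∀ k, 0 ≤ a k ∧ a k ≤ 1) {x : ℝ} (hx0 : 0 ≤ x) (hx1 : x < 1) :
    Summable (fun k => a k * x ^ k) :=
  Summable.of_nonneg_of_le (fun k => mul_nonneg (ha k).1 (pow_nonneg hx0 k))
    (fun k => mul_le_of_le_one_left (pow_nonneg hx0 k) (ha k).2)
    (summable_geometric_of_lt_one hx0 hx1)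

lemma per_sum (a : ℕ → ℝ) (ha : ∀ k, 0 ≤ a k ∧ a k ≤ 1) {x : ℝ} (hx0 : 0 ≤ x) (hx1 : x < 1)
    (m : ℕ) (hm : m ≠ 0) (hper : ∀ k, a (k + m) = a k) :
    ∑' k, a k * x ^ k = (∑ r ∈ Finset.range m, a r * x ^ r) / (1 - x ^ m) := by
  have hs := summ_aux a ha hx0 hx1
  have h := hs.sum_add_tsum_nat_add m
  have h2 : ∑' k, a (k + m) * x ^ (k + m) = x ^ m * ∑' k, a k * x ^ k := by
    rw [← tsum_mul_left]
    congr 1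
    ext k
    rw [hper, pow_add]; ring
  rw [h2] at h
  have h3 : x ^ m < 1 := pow_lt_one₀ hx0 hx1 hm
  rw [eq_div_iff (by linarith)]
  linear_combination -h

noncomputable def FF (s : ℝ) (p : ℕ) : ℝ := ∑' e : ℕ, t23 (p ^ e) * ((p : ℝ) ^ (-s)) ^ e

lemma x_bd {s : ℝ} (hs : 1 < s) {p : ℕ} (hp : p.Prime) :
    0 ≤ (p : ℝ) ^ (-s) ∧ (p : ℝ) ^ (-s) ≤ 1 / 2 := by
  have h2 : (2 : ℝ) ≤ p := by exact_mod_cast hp.two_le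
  refine ⟨by positivity, ?_⟩
  calc (p : ℝ) ^ (-s) ≤ (p : ℝ) ^ (-1 : ℝ) := Real.rpow_le_rpow_of_exponent_le (by linarith) (by linarith)
    _ = (p : ℝ)⁻¹ := Real.rpow_neg_one _
    _ ≤ 1 / 2 := by rw [one_div]; exact inv_anti₀ (by norm_num) h2

lemma x_pow {s : ℝ} (p k : ℕ) : (p : ℝ) ^ (-((k : ℝ) * s)) = ((p : ℝ) ^ (-s)) ^ k := by
  rw [← Real.rpow_mul_natCast (Nat.cast_nonneg p)]
  congr 1; ring

lemma FF_bound {s : ℝ} (hs : 1 < s) {p : ℕ} (hp : p.Prime) :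
    ‖FF s p - 1‖ ≤ 2 * (p : ℝ) ^ (-s) := by
  obtain ⟨h0, h1⟩ := x_bd hs hp
  set x := (p : ℝ) ^ (-s) with hx
  have hsum := summ_aux (fun k => t23 (p ^ k)) (fun k => t23_bound _) h0 (by linarith)
  have e1 : FF s p - 1 = x * ∑' k, t23 (p ^ (k + 1)) * x ^ k := by
    unfold FF
    rw [← hx, hsum.tsum_eq_zero_add, ← tsum_mul_left]
    simp only [pow_zero, t23_one, mul_one, add_sub_cancel_left]
    congr 1
    ext k
    ring
  have hsum' := summ_aux (fun k => t23 (p ^ (k + 1))) (fun k => t23_bound _) h0 (by linarith)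
  have e2 : ∑' k, t23 (p ^ (k + 1)) * x ^ k ≤ ∑' k, x ^ k :=
    hsum'.tsum_le_tsum (fun k => mul_le_of_le_one_left (pow_nonneg h0 k) (t23_bound _).2)
      (summable_geometric_of_lt_one h0 (by linarith))
  rw [tsum_geometric_of_lt_one h0 (by linarith)] at e2
  have e3 : (1 - x)⁻¹ ≤ 2 := by
    rw [inv_le_comm₀ (by linarith) (by norm_num)]; linarith
  have e4 : 0 ≤ ∑' k, t23 (p ^ (k + 1)) * x ^ k :=
    tsum_nonneg (fun k => mul_nonneg (t23_bound _).1 (pow_nonneg h0 k))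
  rw [e1, Real.norm_of_nonneg (mul_nonneg h0 e4), mul_comm]
  exact mul_le_mul_of_nonneg_right (by linarith) h0

lemma FF_mult {s : ℝ} (hs : 1 < s) (P : ℕ → Prop) (hP : ∀ p, P p → p.Prime) :
    Multipliable (fun p : {p : ℕ // P p} => FF s p.1) := by
  have h : Summable (fun p : {p : ℕ // P p} => ‖FF s p.1 - 1‖) := by
    have hs1 : Summable (fun n : ℕ => 2 * (n : ℝ) ^ (-s)) :=
      (Real.summable_nat_rpow.mpr (by linarith)).mul_left 2
    have hs2 : Summable (fun p : {p : ℕ // P p} => 2 * (p.1 : ℝ) ^ (-s)) :=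
      hs1.comp_injective Subtype.val_injective
    exact Summable.of_nonneg_of_le (fun _ => norm_nonneg _) (fun p => FF_bound hs (hP _ p.2)) hs2
  have := multipliable_one_add_of_summable h
  simpa using this

lemma FF_ram {s : ℝ} (hs : 1 < s) : FF s 23 = (1 - (23 : ℝ) ^ (-s))⁻¹ := by
  have hp : Nat.Prime 23 := by norm_num
  obtain ⟨h0, h1⟩ := x_bd hs hp
  unfold FF
  have ht : ∀ k, t23 (23 ^ k) = 1 := fun k => by
    rw [t23_pow hp Hk_ram, ww_ram, if_neg (by decide)]
  rw [per_sum (fun k => t23 (23 ^ k)) (fun k => t23_bound _) h0 (lt_of_le_of_lt h1 (by norm_num)) 1 (by norm_num)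
    (fun k => by simp only [ht])]
  simp [t23_one]

lemma FF_inert {s : ℝ} (hs : 1 < s) {p : ℕ} (hp : p.Prime) (h : legendreSym 23 p = -1) :
    FF s p = (1 - (p : ℝ) ^ (-(2 * s)))⁻¹ := by
  obtain ⟨h0, h1⟩ := x_bd hs hp
  obtain ⟨hh1, _, hh3⟩ := inert_ns hp h
  have H := Hk_inert hp hh1 hh3
  have e := x_pow (s := s) p 2
  push_cast at e
  rw [e]
  unfold FF
  rw [per_sum (fun k => t23 (p ^ k)) (fun k => t23_bound _) h0 (by linarith) 2 (by norm_num)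
    (fun k => by
      simp only [t23_pow hp H]
      rw [ww]; simp)]
  have t1 : t23 p = 0 := by
    have := t23_pow hp H 1
    simpa [ww] using this
  simp [Finset.sum_range_succ, t23_one, t1]

lemma FF_nonpr {s : ℝ} (hs : 1 < s) {p : ℕ} (hp : p.Prime) (H : Hk p (-1) 1) :
    FF s p = (1 + (p : ℝ) ^ (-s)) / (1 - (p : ℝ) ^ (-(3 * s))) := by
  obtain ⟨h0, h1⟩ := x_bd hs hp
  have e := x_pow (s := s) p 3
  push_cast at e
  rw [e]
  unfold FF
  rw [per_sum (fun k => t23 (p ^ k)) (fun k => t23_bound _) h0 (by linarith) 3 (by norm_num)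
    (fun k => by
      simp only [t23_pow hp H]
      rw [ww, ww]; simp)]
  have t1 : t23 p = 1 := by
    have := t23_pow hp H 1
    simpa [ww] using this
  have t2 : t23 (p ^ 2) = 0 := by
    have := t23_pow hp H 2
    simpa [ww] using this
  simp [Finset.sum_range_succ, t23_one, t1, t2]

lemma FF_princ {s : ℝ} (hs : 1 < s) {p : ℕ} (hp : p.Prime) (H : Hk p 2 1) :
    FF s p = (1 - (p : ℝ) ^ (-(22 * s)))
              / ((1 - (p : ℝ) ^ (-s)) * (1 - (p : ℝ) ^ (-(23 * s)))) := by
  obtain ⟨h0, h1⟩ := x_bd hs hp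
  have e := x_pow (s := s) p 22
  have e' := x_pow (s := s) p 23
  push_cast at e e'
  rw [e, e']
  unfold FF
  have h23 : (23 : ZMod 23) = 0 := by decide
  have ht : ∀ k, t23 (p ^ k) = if ((k + 1 : ℕ) : ZMod 23) = 0 then 0 else 1 := by
    intro k
    rw [t23_pow hp H, ww_princ]; push_cast; rfl
  rw [per_sum (fun k => t23 (p ^ k)) (fun k => t23_bound _) h0 (by linarith) 23 (by norm_num)
    (fun k => by
      simp only [ht]
      have : ((k + 23 + 1 : ℕ) : ZMod 23) = ((k + 1 : ℕ) : ZMod 23) := by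
        push_cast; rw [h23]; ring
      rw [this])]
  have hlast : t23 (p ^ 22) = 0 := by
    rw [ht, if_pos (by rfl)]
  rw [Finset.sum_range_succ, hlast, zero_mul, add_zero]
  have hsum : ∑ r ∈ Finset.range 22, t23 (p ^ r) * ((p : ℝ) ^ (-s)) ^ r =
      ∑ r ∈ Finset.range 22, ((p : ℝ) ^ (-s)) ^ r := by
    apply Finset.sum_congr rfl
    intro r hr
    rw [Finset.mem_range] at hr
    rw [ht, if_neg, one_mul]
    rw [ZMod.natCast_eq_zero_iff]
    intro hd
    have := Nat.le_of_dvd (by omega) hd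
    omega
  rw [hsum, geom_sum_eq (by linarith : (p : ℝ) ^ (-s) ≠ 1), div_div]
  rw [← neg_div_neg_eq]
  congr 1 <;> ring

lemma euler_main {s : ℝ} (hs : 1 < s) :
    HasProd (fun p : Nat.Primes => FF s p) (∑' n : ℕ, t23 n * (n : ℝ) ^ (-s)) := by
  have hsm : Summable (fun n : ℕ => (n : ℝ) ^ (-s)) := Real.summable_nat_rpow.mpr (by linarith)
  have h := EulerProduct.eulerProduct_hasProd (f := fun n : ℕ => t23 n * (n : ℝ) ^ (-s))
    (by simp [t23_one])
    (by
      intro m n hmn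
      rw [t23_mul hmn, Nat.cast_mul, Real.mul_rpow (Nat.cast_nonneg m) (Nat.cast_nonneg n)]
      ring)
    (Summable.of_nonneg_of_le (fun _ => norm_nonneg _) (fun n => by
      rw [Real.norm_of_nonneg (mul_nonneg (t23_bound n).1 (by positivity))]
      exact mul_le_of_le_one_left (by positivity) (t23_bound n).2) hsm)
    (by simp [t23_zero])
  have hF : (fun p : Nat.Primes => FF s p) =
      fun p : Nat.Primes => ∑' e : ℕ, t23 ((p : ℕ) ^ e) * (((p : ℕ) ^ e : ℕ) : ℝ) ^ (-s) := by
    ext p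
    unfold FF
    congr 1
    ext e
    rw [← Real.rpow_mul_natCast (Nat.cast_nonneg _), Nat.cast_pow,
      ← Real.rpow_natCast_mul (Nat.cast_nonneg _)]
    congr 2
    ring
  rw [hF]
  exact h

theorem euler_product_T_twentythree (s : ℝ) (hs : 1 < s) :
    (∑' n : ℕ, t23 (n + 1) / ((n : ℝ) + 1) ^ s)
      = (1 - (23 : ℝ) ^ (-s))⁻¹
        * (∏' p : {p : ℕ // p.Prime ∧ legendreSym 23 p = -1},
            (1 - (p.1 : ℝ) ^ (-(2 * s)))⁻¹)
        * (∏' p : {p : ℕ // p.Prime ∧ p ≠ 23 ∧ legendreSym 23 p ≠ -1 ∧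
              ¬ (∃ U V : ℤ, U ≠ 0 ∧ (p : ℤ) = U ^ 2 + 23 * V ^ 2)},
            (1 + (p.1 : ℝ) ^ (-s)) / (1 - (p.1 : ℝ) ^ (-(3 * s))))
        * (∏' p : {p : ℕ // p.Prime ∧ ∃ U V : ℤ, U ≠ 0 ∧ (p : ℤ) = U ^ 2 + 23 * V ^ 2},
            (1 - (p.1 : ℝ) ^ (-(22 * s)))
              / ((1 - (p.1 : ℝ) ^ (-s)) * (1 - (p.1 : ℝ) ^ (-(23 * s))))) := by
  have hL : (∑' n : ℕ, t23 (n + 1) / ((n : ℝ) + 1) ^ s) = ∑' n : ℕ, t23 n * (n : ℝ) ^ (-s) := by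
    have hsm : Summable (fun n : ℕ => t23 n * (n : ℝ) ^ (-s)) :=
      Summable.of_nonneg_of_le (fun n => mul_nonneg (t23_bound n).1 (by positivity))
        (fun n => mul_le_of_le_one_left (by positivity) (t23_bound n).2)
        (Real.summable_nat_rpow.mpr (by linarith : -s < -1))
    rw [hsm.tsum_eq_zero_add, t23_zero, zero_mul, zero_add]
    congr 1
    ext n
    rw [Real.rpow_neg (Nat.cast_nonneg _), div_eq_mul_inv]
    push_cast
    rfl
  rw [hL]
  have m0 : HasProd (FF s ∘ (Subtype.val : ({23} : Set ℕ) → ℕ)) (FF s 23) :=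
    hasProd_unique (FF s ∘ (Subtype.val : ({23} : Set ℕ) → ℕ))
  have m1 : HasProd (FF s ∘ (Subtype.val : {p : ℕ | p.Prime ∧ legendreSym 23 p = -1} → ℕ)) _ :=
    (FF_mult hs (fun p => p.Prime ∧ legendreSym 23 p = -1) (fun p h => h.1)).hasProd
  have m2 : HasProd (FF s ∘ (Subtype.val : {p : ℕ | p.Prime ∧ p ≠ 23 ∧ legendreSym 23 p ≠ -1 ∧
              ¬ (∃ U V : ℤ, U ≠ 0 ∧ (p : ℤ) = U ^ 2 + 23 * V ^ 2)} → ℕ)) _ :=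
    (FF_mult hs (fun p => p.Prime ∧ p ≠ 23 ∧ legendreSym 23 p ≠ -1 ∧
              ¬ (∃ U V : ℤ, U ≠ 0 ∧ (p : ℤ) = U ^ 2 + 23 * V ^ 2)) (fun p h => h.1)).hasProd
  have m3 : HasProd (FF s ∘ (Subtype.val : {p : ℕ | p.Prime ∧
              ∃ U V : ℤ, U ≠ 0 ∧ (p : ℤ) = U ^ 2 + 23 * V ^ 2} → ℕ)) _ :=
    (FF_mult hs (fun p => p.Prime ∧
              ∃ U V : ℤ, U ≠ 0 ∧ (p : ℤ) = U ^ 2 + 23 * V ^ 2) (fun p h => h.1)).hasProd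
  have m01 := m0.mul_disjoint (by
    rw [Set.disjoint_left]
    rintro x hx ⟨hp, h⟩
    have hx' : x = 23 := hx
    exact (inert_ns hp h).2.1 hx') m1
  have m012 := m01.mul_disjoint (by
    rw [Set.disjoint_left]
    rintro x hx ⟨hp, h1, h2, h3⟩
    rcases hx with hx | hx
    · exact h1 hx
    · exact h2 hx.2) m2
  have m0123 := m012.mul_disjoint (by
    rw [Set.disjoint_left]
    rintro x hx ⟨hp, h⟩
    obtain ⟨U, V, hU, hUV⟩ := h
    have hl := princ_leg hp hU hUV
    rcases hx with (hx | hx) | hx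
    · exact hl.1 hx
    · exact hl.2 hx.2
    · exact hx.2.2.2 ⟨U, V, hU, hUV⟩) m3
  have hset : (({23} ∪ {p : ℕ | p.Prime ∧ legendreSym 23 p = -1}) ∪
      {p : ℕ | p.Prime ∧ p ≠ 23 ∧ legendreSym 23 p ≠ -1 ∧
              ¬ (∃ U V : ℤ, U ≠ 0 ∧ (p : ℤ) = U ^ 2 + 23 * V ^ 2)}) ∪
      {p : ℕ | p.Prime ∧ ∃ U V : ℤ, U ≠ 0 ∧ (p : ℤ) = U ^ 2 + 23 * V ^ 2} = {p : ℕ | p.Prime} := by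
    ext p
    constructor
    · rintro (((h | h) | h) | h)
      · have h' : p = 23 := h
        subst h'
        exact (by norm_num : Nat.Prime 23)
      · exact h.1
      · exact h.1
      · exact h.1
    · intro hp
      have hp' : p.Prime := hp
      by_cases h23 : p = 23
      · exact Or.inl (Or.inl (Or.inl h23))
      by_cases hl : legendreSym 23 p = -1
      · exact Or.inl (Or.inl (Or.inr ⟨hp', hl⟩))
      by_cases hpr : ∃ U V : ℤ, U ≠ 0 ∧ (p : ℤ) = U ^ 2 + 23 * V ^ 2
      · exact Or.inr ⟨hp', hpr⟩
      · exact Or.inl (Or.inr ⟨hp', h23, hl, hpr⟩)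
  rw [hset] at m0123
  have hu := (euler_main hs).unique m0123
  rw [hu, FF_ram hs]
  congr 1
  · congr 1
    · congr 1
      apply tprod_congr
      rintro ⟨p, hp, h⟩
      exact FF_inert hs hp h
    · apply tprod_congr
      rintro ⟨p, hp, h1, h2, h3⟩
      obtain ⟨a, b, h, h'⟩ := nonpr_rep hp h1 h2 h3
      exact FF_nonpr hs hp (Hk_nonpr hp h1 h h')
  · apply tprod_congr
    rintro ⟨p, hp, U, V, hU, h⟩
    exact FF_princ hs hp (Hk_princ hp hU h)
end
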